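/- arXiv:1711.04381 — 2 statements merged into one kernel-verified Lean document; each statement's English description precedes it below -/
import Mathlib

section
/- Let n ≥ 3 and let A_ε := {x ∈ ℝⁿ : ε < ‖x‖ < 1} for 0 < ε < 1. Then lim_{ε → 1⁻} σ₁(A_ε) = 0. -/
open MeasureTheory Filter

/-- The first nonzero Steklov eigenvalue of a domain `Ω ⊆ ℝⁿ`, defined variationally. -/
noncomputable def stekSigma1 {n : ℕ} (Ω : Set (EuclideanSpace ℝ (Fin n))) : ℝ :=
  sInf { q : ℝ | ∃ f : EuclideanSpace ℝ (Fin n) → ℝ, ContDiff ℝ (⊤ : ℕ∞) f ∧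
    (∫ x in frontier Ω, f x ∂(μH[(n : ℝ) - 1])) = 0 ∧
    (0 < ∫ x in frontier Ω, (f x) ^ 2 ∂(μH[(n : ℝ) - 1])) ∧
    q = (∫ x in Ω, ‖gradient f x‖ ^ 2) /
        (∫ x in frontier Ω, (f x) ^ 2 ∂(μH[(n : ℝ) - 1])) }

open Metric Module in
/-- The half of the unit sphere facing away from a unit vector `v` has finite codimension-one
Hausdorff measure. -/
theorem hausdorffMeasure_hemisphere_lt_top {E : Type*} [NormedAddCommGroup E]
    [InnerProductSpace ℝ E] [FiniteDimensional ℝ E] [MeasurableSpace E] [BorelSpace E]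
    {v : E} (hv : ‖v‖ = 1) :
    μH[(finrank ℝ E : ℝ) - 1] {x : E | ‖x‖ = 1 ∧ inner ℝ v x ≤ 0} < ⊤ := by
  let W := (Submodule.span ℝ {v})ᗮ
  have hd : (finrank ℝ E : ℝ) - 1 = finrank ℝ W := by
    have h1 := (Submodule.span ℝ {v}).finrank_add_finrank_orthogonal
    rw [finrank_span_singleton (by rintro rfl; simp at hv)] at h1
    rw [← h1]
    push_cast
    ring
  have hsmooth : ContDiff ℝ 1 (fun w : W => stereoInvFunAux v (w : E)) :=
    contDiff_stereoInvFunAux.comp W.subtypeL.contDiff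
  obtain ⟨K, hK⟩ := hsmooth.locallyLipschitz.locallyLipschitzOn.exists_lipschitzOnWith_of_compact
    (isCompact_closedBall (0 : W) 2)
  rw [hd]
  have hsub : {x : E | ‖x‖ = 1 ∧ inner ℝ v x ≤ 0} ⊆
      (fun w : W => stereoInvFunAux v (w : E)) '' closedBall (0 : W) 2 := by
    rintro x ⟨hx, hvx⟩
    refine ⟨stereoToFun v x, ?_, ?_⟩
    · rw [mem_closedBall_zero_iff, stereoToFun_apply, norm_smul]
      have h1 : ‖W.orthogonalProjectionOnto x‖ ≤ 1 := hx ▸ W.norm_orthogonalProjectionOnto_apply_le x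
      have h2 : ‖2 / ((1 : ℝ) - innerSL ℝ v x)‖ ≤ 2 := by
        rw [innerSL_apply_apply, Real.norm_of_nonneg (by apply div_nonneg <;> linarith)]
        exact div_le_self (by norm_num) (by linarith)
      calc _ ≤ (2 : ℝ) * 1 := mul_le_mul h2 h1 (norm_nonneg _) (by norm_num)
        _ = 2 := by norm_num
    · have hne : x ≠ v := by
        rintro rfl
        rw [real_inner_self_eq_norm_sq, hv] at hvx
        norm_num at hvx
      exact congrArg Subtype.val (stereo_left_inv hv (x := ⟨x, by simpa using hx⟩) hne)
  refine (measure_mono hsub).trans_lt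
    ((hK.hausdorffMeasure_image_le (Nat.cast_nonneg _)).trans_lt ?_)
  exact ENNReal.mul_lt_top (ENNReal.rpow_lt_top_of_nonneg (Nat.cast_nonneg _) ENNReal.coe_ne_top)
    (isCompact_closedBall (0 : W) 2).measure_lt_top

open Metric Module in
/-- The unit sphere has finite codimension-one Hausdorff measure. -/
theorem hausdorffMeasure_unitSphere_lt_top {E : Type*} [NormedAddCommGroup E]
    [InnerProductSpace ℝ E] [FiniteDimensional ℝ E] [MeasurableSpace E] [BorelSpace E] :
    μH[(finrank ℝ E : ℝ) - 1] (sphere (0 : E) 1) < ⊤ := by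
  rcases (sphere (0 : E) 1).eq_empty_or_nonempty with h | ⟨v, hv⟩
  · simp [h]
  have hv : ‖v‖ = 1 := by simpa using hv
  refine (measure_mono (t := {x : E | ‖x‖ = 1 ∧ inner ℝ v x ≤ 0} ∪
    {x : E | ‖x‖ = 1 ∧ inner ℝ (-v) x ≤ 0}) fun x hx => ?_).trans_lt
    (measure_union_lt_top (hausdorffMeasure_hemisphere_lt_top hv)
      (hausdorffMeasure_hemisphere_lt_top (by rwa [norm_neg])))
  have hx : ‖x‖ = 1 := by simpa using hx
  rcases le_total (inner ℝ v x) 0 with h | h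
  · exact Or.inl ⟨hx, h⟩
  · exact Or.inr ⟨hx, by rw [inner_neg_left]; linarith⟩

open Metric in
theorem frontier_annulus_subset {E : Type*} [SeminormedAddCommGroup E] (ε : ℝ) :
    frontier {x : E | ε < ‖x‖ ∧ ‖x‖ < 1} ⊆ sphere 0 ε ∪ sphere 0 1 := by
  have hopen : IsOpen {x : E | ε < ‖x‖ ∧ ‖x‖ < 1} :=
    (isOpen_lt continuous_const continuous_norm).inter (isOpen_lt continuous_norm continuous_const)
  have hclosed : IsClosed {x : E | ε ≤ ‖x‖ ∧ ‖x‖ ≤ 1} :=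
    (isClosed_le continuous_const continuous_norm).inter
      (isClosed_le continuous_norm continuous_const)
  intro x hx
  rw [hopen.frontier_eq] at hx
  obtain ⟨h1, h2⟩ := closure_minimal (t := {x : E | ε ≤ ‖x‖ ∧ ‖x‖ ≤ 1})
    (fun y hy => ⟨hy.1.le, hy.2.le⟩) hclosed hx.1
  rw [Set.mem_union, mem_sphere_zero_iff_norm, mem_sphere_zero_iff_norm]
  rcases h1.eq_or_lt with h | h
  · exact Or.inl h.symm
  · exact Or.inr (h2.eq_or_lt.resolve_right fun h' => hx.2 ⟨h, h'⟩)

open Metric in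
theorem unitSphere_subset_frontier_annulus {E : Type*} [NormedAddCommGroup E] [NormedSpace ℝ E]
    {ε : ℝ} (hε₀ : 0 ≤ ε) (hε₁ : ε < 1) :
    sphere 0 1 ⊆ frontier {x : E | ε < ‖x‖ ∧ ‖x‖ < 1} := by
  intro x hx
  have hx : ‖x‖ = 1 := by simpa using hx
  refine ⟨?_, fun h => (interior_subset h).2.ne hx⟩
  have ht : Tendsto (fun t : ℝ => t • x) (nhdsWithin 1 (Set.Iio 1)) (nhds x) := by
    have : Tendsto (fun t : ℝ => t • x) (nhds 1) (nhds ((1 : ℝ) • x)) :=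
      (continuous_id.smul continuous_const).tendsto 1
    rw [one_smul] at this
    exact this.mono_left nhdsWithin_le_nhds
  refine mem_closure_of_tendsto ht ?_
  filter_upwards [Ioo_mem_nhdsLT hε₁] with t ht
  simp only [norm_smul, hx, mul_one, Real.norm_of_nonneg (hε₀.trans ht.1.le)]
  exact ht

open Metric Pointwise in
/-- Up to a factor `ε ^ d`, the spheres of radius `ε` and `1` have the same Hausdorff measure. -/
theorem hausdorffMeasure_sphere {E : Type*} [NormedAddCommGroup E] [NormedSpace ℝ E]
    [MeasurableSpace E] [BorelSpace E] {d ε : ℝ} (hd : 0 ≤ d) (hε : 0 < ε) :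
    μH[d] (sphere (0 : E) ε) = ‖ε‖₊ ^ d • μH[d] (sphere (0 : E) 1) := by
  rw [← Measure.hausdorffMeasure_smul₀ hd hε.ne', smul_sphere' hε.ne', smul_zero, mul_one,
    Real.norm_of_nonneg hε.le]

open Metric in
theorem volume_annulus_le {n : ℕ} {ε : ℝ} (hε₀ : 0 < ε) (hε₁ : ε < 1) :
    volume.real {x : EuclideanSpace ℝ (Fin n) | ε < ‖x‖ ∧ ‖x‖ < 1} ≤
      (1 - ε ^ n) * volume.real (ball (0 : EuclideanSpace ℝ (Fin n)) 1) := by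
  have hsub : {x : EuclideanSpace ℝ (Fin n) | ε < ‖x‖ ∧ ‖x‖ < 1} ⊆ ball 0 1 \ ball 0 ε := by
    rintro x ⟨h1, h2⟩
    simp [h1.le, h2]
  have hfin : volume (ball (0 : EuclideanSpace ℝ (Fin n)) 1 \ ball 0 ε) ≠ ⊤ :=
    measure_ne_top_of_subset Set.sdiff_subset measure_ball_lt_top.ne
  refine (measureReal_mono hsub hfin).trans_eq ?_
  rw [measureReal_sdiff (ball_subset_ball hε₁.le) measurableSet_ball,
    Measure.real, Measure.real, Measure.addHaar_ball_of_pos volume _ hε₀, ENNReal.toReal_mul,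
    ENNReal.toReal_ofReal (by positivity), finrank_euclideanSpace_fin]
  ring

theorem norm_gradient_coord_le {n : ℕ} (i : Fin n) (x : EuclideanSpace ℝ (Fin n)) :
    ‖gradient (fun y : EuclideanSpace ℝ (Fin n) => y i) x‖ ≤ 1 := by
  have h : fderiv ℝ (fun y : EuclideanSpace ℝ (Fin n) => y i) x = EuclideanSpace.proj i :=
    (EuclideanSpace.proj i : EuclideanSpace ℝ (Fin n) →L[ℝ] ℝ).hasFDerivAt.fderiv
  rw [gradient, LinearIsometryEquiv.norm_map, h]
  exact ContinuousLinearMap.opNorm_le_bound _ zero_le_one fun y => by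
    simpa using PiLp.norm_apply_le y i

theorem stekSigma1_nonneg {n : ℕ} (Ω : Set (EuclideanSpace ℝ (Fin n))) : 0 ≤ stekSigma1 Ω := by
  refine Real.sInf_nonneg ?_
  rintro q ⟨f, -, -, h, rfl⟩
  exact div_nonneg (integral_nonneg fun x => sq_nonneg _) h.le

theorem stekSigma1_le {n : ℕ} {Ω : Set (EuclideanSpace ℝ (Fin n))}
    {f : EuclideanSpace ℝ (Fin n) → ℝ} (hf : ContDiff ℝ (⊤ : ℕ∞) f)
    (h0 : (∫ x in frontier Ω, f x ∂(μH[(n : ℝ) - 1])) = 0)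
    (hpos : 0 < ∫ x in frontier Ω, (f x) ^ 2 ∂(μH[(n : ℝ) - 1])) :
    stekSigma1 Ω ≤ (∫ x in Ω, ‖gradient f x‖ ^ 2) /
        (∫ x in frontier Ω, (f x) ^ 2 ∂(μH[(n : ℝ) - 1])) := by
  refine csInf_le ⟨0, ?_⟩ ⟨f, hf, h0, hpos, rfl⟩
  rintro q ⟨f, -, -, h, rfl⟩
  exact div_nonneg (integral_nonneg fun x => sq_nonneg _) h.le

theorem stekSigma1_eq_zero_of_null {n : ℕ} {Ω : Set (EuclideanSpace ℝ (Fin n))}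
    (h : μH[(n : ℝ) - 1] (frontier Ω) = 0) : stekSigma1 Ω = 0 := by
  simp [stekSigma1, Measure.restrict_eq_zero.2 h]

/-- Odd functions have zero integral over symmetric sets for the Hausdorff measure. -/
theorem setIntegral_hausdorffMeasure_eq_zero_of_odd {E : Type*} [NormedAddCommGroup E]
    [MeasurableSpace E] [BorelSpace E] (d : ℝ) {S : Set E} (hS : ∀ x, -x ∈ S ↔ x ∈ S)
    {f : E → ℝ} (hf : ∀ x, f (-x) = -f x) : (∫ x in S, f x ∂μH[d]) = 0 := by
  have hmp : MeasurePreserving (IsometryEquiv.neg E) (μH[d]) (μH[d]) :=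
    (IsometryEquiv.neg E).measurePreserving_hausdorffMeasure d
  have h := hmp.setIntegral_preimage_emb
    (IsometryEquiv.neg E).toHomeomorph.measurableEmbedding f S
  have hpre : (IsometryEquiv.neg E) ⁻¹' S = S := by
    ext x
    exact hS x
  rw [hpre] at h
  simp only [IsometryEquiv.neg_apply, hf, integral_neg] at h
  linarith

theorem neg_mem_frontier_annulus {E : Type*} [SeminormedAddCommGroup E] (ε : ℝ) (x : E) :
    -x ∈ frontier {x : E | ε < ‖x‖ ∧ ‖x‖ < 1} ↔ x ∈ frontier {x : E | ε < ‖x‖ ∧ ‖x‖ < 1} := by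
  have h := (Homeomorph.neg E).preimage_frontier {x : E | ε < ‖x‖ ∧ ‖x‖ < 1}
  have hpre : (Homeomorph.neg E) ⁻¹' {x : E | ε < ‖x‖ ∧ ‖x‖ < 1} = {x : E | ε < ‖x‖ ∧ ‖x‖ < 1} := by
    ext y
    simp
  rw [hpre] at h
  exact Set.ext_iff.1 h x

theorem integrableOn_coord_sq_of_subset_closedBall {n : ℕ} (i : Fin n)
    {μ : Measure (EuclideanSpace ℝ (Fin n))} {S : Set (EuclideanSpace ℝ (Fin n))}
    (hS : S ⊆ Metric.closedBall 0 1) (hSm : MeasurableSet S) (hμ : μ S ≠ ⊤) :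
    IntegrableOn (fun x => x i ^ 2) S μ := by
  refine Measure.integrableOn_of_bounded hμ
    (by fun_prop : Continuous fun x : EuclideanSpace ℝ (Fin n) => x i ^ 2).aestronglyMeasurable
    (M := 1) ?_
  filter_upwards [ae_restrict_mem hSm] with x hx
  rw [norm_pow]
  exact pow_le_one₀ (norm_nonneg _)
    ((PiLp.norm_apply_le x i).trans (by simpa using hS hx))

/-- If the unit sphere is not a null set, some coordinate function has positive `L²` norm on it. -/
theorem exists_coord_integral_sq_pos {n : ℕ} {μ : Measure (EuclideanSpace ℝ (Fin n))}
    (h0 : μ (Metric.sphere 0 1) ≠ 0) (hfin : μ (Metric.sphere 0 1) ≠ ⊤) :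
    ∃ i : Fin n, 0 < ∫ x in Metric.sphere 0 1, x i ^ 2 ∂μ := by
  have hm : MeasurableSet (Metric.sphere (0 : EuclideanSpace ℝ (Fin n)) 1) :=
    Metric.isClosed_sphere.measurableSet
  have hsum : ∑ i : Fin n, (∫ x in Metric.sphere 0 1, x i ^ 2 ∂μ) =
      μ.real (Metric.sphere (0 : EuclideanSpace ℝ (Fin n)) 1) := by
    rw [← integral_finsetSum _ fun i _ =>
      integrableOn_coord_sq_of_subset_closedBall i Metric.sphere_subset_closedBall hm hfin]
    rw [setIntegral_congr_fun (g := fun _ => (1 : ℝ)) hm, setIntegral_const, smul_eq_mul, mul_one]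
    intro x hx
    have hx : ‖x‖ = 1 := by simpa using hx
    have := EuclideanSpace.real_norm_sq_eq x
    simp only [← this, hx, one_pow]
  have hpos : 0 < μ.real (Metric.sphere (0 : EuclideanSpace ℝ (Fin n)) 1) :=
    ENNReal.toReal_pos h0 hfin
  by_contra! hcon
  exact absurd (Finset.sum_nonpos fun i (_ : i ∈ Finset.univ) => hcon i) (by linarith)

/-- The first Steklov eigenvalue of the annulus `A_ε = {ε < ‖x‖ < 1}` tends to `0` as
`ε → 1⁻`. -/
theorem stmt16 {n : ℕ} (hn : 3 ≤ n) :
    Tendsto (fun ε : ℝ => stekSigma1 {x : EuclideanSpace ℝ (Fin n) | ε < ‖x‖ ∧ ‖x‖ < 1})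
      (nhdsWithin 1 (Set.Iio 1)) (nhds 0) := by
  have hd : (0 : ℝ) ≤ (n : ℝ) - 1 := by
    have : (3 : ℝ) ≤ n := by exact_mod_cast hn
    linarith
  have hfin : μH[(n : ℝ) - 1] (Metric.sphere (0 : EuclideanSpace ℝ (Fin n)) 1) ≠ ⊤ := by
    have := hausdorffMeasure_unitSphere_lt_top (E := EuclideanSpace ℝ (Fin n))
    rw [finrank_euclideanSpace_fin] at this
    exact this.ne
  have hnear : Set.Ioo (0 : ℝ) 1 ∈ nhdsWithin (1 : ℝ) (Set.Iio 1) := Ioo_mem_nhdsLT one_pos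
  by_cases h0 : μH[(n : ℝ) - 1] (Metric.sphere (0 : EuclideanSpace ℝ (Fin n)) 1) = 0
  · refine tendsto_const_nhds.congr' ?_
    filter_upwards [hnear] with ε hε
    refine (stekSigma1_eq_zero_of_null
      (measure_mono_null (frontier_annulus_subset ε) (measure_union_null ?_ h0))).symm
    rw [hausdorffMeasure_sphere hd hε.1, h0, smul_zero]
  obtain ⟨i, hi⟩ := exists_coord_integral_sq_pos h0 hfin
  set c := ∫ x in Metric.sphere (0 : EuclideanSpace ℝ (Fin n)) 1, x i ^ 2 ∂μH[(n : ℝ) - 1]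
  set V := volume.real (Metric.ball (0 : EuclideanSpace ℝ (Fin n)) 1)
  have hlim : Tendsto (fun ε : ℝ => (1 - ε ^ n) * V / c) (nhdsWithin 1 (Set.Iio 1)) (nhds 0) := by
    have hcont : Continuous fun ε : ℝ => (1 - ε ^ n) * V / c := by fun_prop
    have := hcont.tendsto 1
    simp only [one_pow, sub_self, zero_mul, zero_div] at this
    exact this.mono_left nhdsWithin_le_nhds
  refine squeeze_zero' (Eventually.of_forall fun ε => stekSigma1_nonneg _) ?_ hlim
  filter_upwards [hnear] with ε hε
  set A := {x : EuclideanSpace ℝ (Fin n) | ε < ‖x‖ ∧ ‖x‖ < 1}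
  have hball : frontier A ⊆ Metric.closedBall 0 1 :=
    (frontier_annulus_subset ε).trans (Set.union_subset
      (Metric.sphere_subset_closedBall.trans (Metric.closedBall_subset_closedBall hε.2.le))
      Metric.sphere_subset_closedBall)
  have hFfin : μH[(n : ℝ) - 1] (frontier A) ≠ ⊤ := by
    refine measure_ne_top_of_subset (frontier_annulus_subset ε) (measure_union_ne_top ?_ hfin)
    rw [hausdorffMeasure_sphere hd hε.1]
    exact ENNReal.mul_ne_top ENNReal.coe_ne_top hfin
  have hc : c ≤ ∫ x in frontier A, x i ^ 2 ∂μH[(n : ℝ) - 1] :=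
    setIntegral_mono_set
      (integrableOn_coord_sq_of_subset_closedBall i hball isClosed_frontier.measurableSet hFfin)
      (Eventually.of_forall fun x => sq_nonneg _)
      (unitSphere_subset_frontier_annulus hε.1.le hε.2).eventuallyLE
  have hAfin : volume A < ⊤ :=
    (measure_mono fun x hx => by simpa using hx.2).trans_lt
      (measure_ball_lt_top (x := (0 : EuclideanSpace ℝ (Fin n))) (r := 1))
  have hgrad : (∫ x in A, ‖gradient (fun y : EuclideanSpace ℝ (Fin n) => y i) x‖ ^ 2) ≤
      (1 - ε ^ n) * V := by
    refine le_trans ?_ (volume_annulus_le hε.1 hε.2)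
    refine (Real.le_norm_self _).trans ((norm_setIntegral_le_of_norm_le_const hAfin (C := 1)
      fun x _ => ?_).trans_eq (one_mul _))
    rw [norm_pow, norm_norm]
    exact pow_le_one₀ (norm_nonneg _) (norm_gradient_coord_le i x)
  refine (stekSigma1_le (f := fun x => x i) (by fun_prop)
    (setIntegral_hausdorffMeasure_eq_zero_of_odd _ (neg_mem_frontier_annulus ε) fun x => rfl)
    (hi.trans_le hc)).trans ?_
  exact div_le_div₀ ((integral_nonneg fun x => sq_nonneg _).trans hgrad) hgrad hi hc
end

section
/- Let n ≥ 3. Define F : [0,1) → ℝ by F(0) := σ₁(B₁) · H^{n−1}(∂B₁)^{1/(n−1)} where B₁ is the open unit ball in ℝⁿ, and F(ε) := σ₁(A_ε) · H^{n−1}(∂A_ε)^{1/(n−1)} for ε ∈ (0,1), where A_ε := {x ∈ ℝⁿ : ε < ‖x‖ < 1}. Then there exists ε* ∈ (0,1) such that F(ε) ≤ F(ε*) for all ε ∈ [0,1), and F(ε*) > F(0). -/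
open MeasureTheory

/-- The first argument is continuous and has a bounded measurable derivative, given by the
second argument, off a countable set. -/
def HasBddDerivOffCountable (k k' : ℝ → ℝ) : Prop :=
  Continuous k ∧ Measurable k' ∧ (∃ C, ∀ s, |k' s| ≤ C) ∧
    ∃ N : Set ℝ, N.Countable ∧ ∀ s ∉ N, HasDerivAt k (k' s) s

namespace HasBddDerivOffCountable

variable {k k' l l' : ℝ → ℝ}

lemma comp_add_const (h : HasBddDerivOffCountable k k') (a : ℝ) :
    HasBddDerivOffCountable (fun s => k (s + a)) (fun s => k' (s + a)) := by
  obtain ⟨hc, hm, ⟨C, hC⟩, N, hN, hd⟩ := h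
  refine ⟨by fun_prop, by fun_prop, ⟨C, fun s => hC _⟩, (fun s => s + a) ⁻¹' N,
    hN.preimage (add_left_injective a), fun s hs => (hd (s + a) hs).comp_add_const s a⟩

lemma const_mul (h : HasBddDerivOffCountable k k') (c : ℝ) :
    HasBddDerivOffCountable (fun s => c * k s) (fun s => c * k' s) := by
  obtain ⟨hc, hm, ⟨C, hC⟩, N, hN, hd⟩ := h
  refine ⟨by fun_prop, by fun_prop, ⟨|c| * C, fun s => ?_⟩, N, hN,
    fun s hs => (hd s hs).const_mul c⟩
  rw [abs_mul]
  gcongr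
  exact hC s

lemma add (h : HasBddDerivOffCountable k k') (h2 : HasBddDerivOffCountable l l') :
    HasBddDerivOffCountable (fun s => k s + l s) (fun s => k' s + l' s) := by
  obtain ⟨hc, hm, ⟨C, hC⟩, N, hN, hd⟩ := h
  obtain ⟨hc2, hm2, ⟨C2, hC2⟩, N2, hN2, hd2⟩ := h2
  refine ⟨by fun_prop, by fun_prop, ⟨C + C2, fun s => (abs_add_le _ _).trans
    (add_le_add (hC s) (hC2 s))⟩, N ∪ N2, hN.union hN2, fun s hs => ?_⟩
  simp only [Set.mem_union, not_or] at hs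
  exact (hd s hs.1).add (hd2 s hs.2)

lemma sub (h : HasBddDerivOffCountable k k') (h2 : HasBddDerivOffCountable l l') :
    HasBddDerivOffCountable (fun s => k s - l s) (fun s => k' s - l' s) := by
  simpa [sub_eq_add_neg] using h.add (h2.const_mul (-1))

lemma intervalIntegrable_sq (h : HasBddDerivOffCountable k k') (a b : ℝ) :
    IntervalIntegrable (fun s => k' s ^ 2) volume a b := by
  obtain ⟨hc, hm, ⟨C, hC⟩, -⟩ := h
  refine (intervalIntegrable_const (c := C ^ 2)).mono_fun (by fun_prop) (ae_of_all _ fun s => ?_)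
  simp only [Real.norm_of_nonneg (sq_nonneg _)]
  exact sq_le_sq' (abs_le.1 (hC s)).1 (abs_le.1 (hC s)).2

lemma sq_intervalIntegrable (h : HasBddDerivOffCountable k k') (a b : ℝ) :
    IntervalIntegrable (fun s => k s ^ 2) volume a b :=
  (h.1.pow 2).intervalIntegrable _ _

/-- Friedrichs' inequality with a constant below the optimal one. -/
lemma mul_integral_sq_le (h : HasBddDerivOffCountable k k') {s₀ L c : ℝ} (hL : 0 < L)
    (hc : 0 < c) (hcL : c * L < Real.pi) (h0 : k s₀ = 0) (h1 : k (s₀ + L) = 0) :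
    c ^ 2 * ∫ s in s₀..(s₀ + L), k s ^ 2 ≤ ∫ s in s₀..(s₀ + L), k' s ^ 2 := by
  have hle : s₀ ≤ s₀ + L := by linarith
  obtain ⟨hcont, hm, ⟨C, hC⟩, N, hN, hd⟩ := id h
  set φ : ℝ → ℝ := fun s => -c * Real.tan (c * (s - (s₀ + L / 2))) with hφ
  have hcos : ∀ s ∈ Set.Icc s₀ (s₀ + L), Real.cos (c * (s - (s₀ + L / 2))) ≠ 0 := by
    intro s hs
    apply ne_of_gt
    apply Real.cos_pos_of_mem_Ioo
    constructor <;> nlinarith [hs.1, hs.2]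
  have hφd : ∀ s ∈ Set.Icc s₀ (s₀ + L), HasDerivAt φ (-c ^ 2 - φ s ^ 2) s := by
    intro s hs
    have h2 : HasDerivAt (fun s => c * (s - (s₀ + L / 2))) c s := by
      simpa using ((hasDerivAt_id s).sub_const (s₀ + L / 2)).const_mul c
    have h3 := ((Real.hasDerivAt_tan (hcos s hs)).comp s h2).const_mul (-c)
    refine h3.congr_deriv ?_
    have hne := hcos s hs
    simp only [hφ, Real.tan_eq_sin_div_cos]
    have := Real.sin_sq_add_cos_sq (c * (s - (s₀ + L / 2)))
    generalize c * (s - (s₀ + L / 2)) = t at *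
    field_simp
    linear_combination this
  have hφc : ContinuousOn φ (Set.Icc s₀ (s₀ + L)) := fun s hs =>
    (hφd s hs).continuousAt.continuousWithinAt
  obtain ⟨M, hM⟩ := isCompact_Icc.exists_bound_of_continuousOn hφc
  have hdint : IntervalIntegrable k' volume s₀ (s₀ + L) :=
    (intervalIntegrable_const (c := C)).mono_fun (by fun_prop) (ae_of_all _ fun s =>
      by simp only [Real.norm_eq_abs]; exact (hC s).trans (le_abs_self C))
  have hu : Set.uIcc s₀ (s₀ + L) = Set.Icc s₀ (s₀ + L) := Set.uIcc_of_le hle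
  have hintg : IntervalIntegrable
      (fun s => (-c ^ 2 - φ s ^ 2) * k s ^ 2 + φ s * k s * 2 * k' s) volume s₀ (s₀ + L) := by
    apply IntervalIntegrable.add
    · apply ContinuousOn.intervalIntegrable
      rw [hu]
      fun_prop
    · apply hdint.continuousOn_mul
      rw [hu]
      fun_prop
  have key := integral_eq_of_hasDerivAt_off_countable_of_le (fun s => φ s * k s ^ 2)
    (fun s => (-c ^ 2 - φ s ^ 2) * k s ^ 2 + φ s * k s * 2 * k' s) hle hN (by fun_prop)
    (fun s hs => by
      refine ((hφd s (Set.Ioo_subset_Icc_self hs.1)).mul ((hd s hs.2).pow 2)).congr_deriv ?_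
      simp only [Pi.pow_apply]
      push_cast
      ring) hintg
  simp only [h0, h1] at key
  have h3 : 0 ≤ ∫ s in s₀..(s₀ + L), (k' s - φ s * k s) ^ 2 :=
    intervalIntegral.integral_nonneg hle fun s _ => sq_nonneg _
  have h4 : ∫ s in s₀..(s₀ + L), (k' s - φ s * k s) ^ 2 = ∫ s in s₀..(s₀ + L),
      ((k' s ^ 2 - c ^ 2 * k s ^ 2) -
        ((-c ^ 2 - φ s ^ 2) * k s ^ 2 + φ s * k s * 2 * k' s)) := by
    congr 1; ext s; ring
  have h5 := (h.sq_intervalIntegrable s₀ (s₀ + L)).const_mul (c ^ 2)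
  have h6 := h.intervalIntegrable_sq s₀ (s₀ + L)
  rw [h4, intervalIntegral.integral_sub (h6.sub h5) hintg, key,
    intervalIntegral.integral_sub h6 h5, intervalIntegral.integral_const_mul] at h3
  linarith

/-- Wirtinger's inequality for antiperiodic functions. -/
lemma integral_sq_le_of_antiperiodic (h : HasBddDerivOffCountable k k') {L : ℝ} (hL : 0 < L)
    (hk : ∀ s, k (s + L) = -k s) (hk' : ∀ s, k' (s + L) = -k' s) :
    ∫ s in 0..L, k s ^ 2 ≤ (L / Real.pi) ^ 2 * ∫ s in 0..L, k' s ^ 2 := by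
  obtain ⟨s₀, h0⟩ : ∃ s₀, k s₀ = 0 := by
    have := hk 0
    rcases le_total (k 0) 0 with h1 | h1
    · exact mem_range_of_exists_le_of_exists_ge h.1 ⟨0, h1⟩ ⟨0 + L, by linarith⟩
    · exact mem_range_of_exists_le_of_exists_ge h.1 ⟨0 + L, by linarith⟩ ⟨0, h1⟩
  have hp : Function.Periodic (fun s => k s ^ 2) L := fun s => by simp [hk]
  have hp' : Function.Periodic (fun s => k' s ^ 2) L := fun s => by simp [hk']
  have e1 := hp.intervalIntegral_add_eq 0 s₀
  have e2 := hp'.intervalIntegral_add_eq 0 s₀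
  rw [zero_add] at e1 e2
  rw [e1, e2]
  have hpi := Real.pi_pos
  have h1 : k (s₀ + L) = 0 := by rw [hk, h0, neg_zero]
  have h2 : (Real.pi / L) ^ 2 * ∫ s in s₀..(s₀ + L), k s ^ 2 ≤
      ∫ s in s₀..(s₀ + L), k' s ^ 2 := by
    have hlim : Filter.Tendsto (fun c : ℝ => c ^ 2 * ∫ s in s₀..(s₀ + L), k s ^ 2)
        (nhdsWithin (Real.pi / L) (Set.Iio (Real.pi / L)))
        (nhds ((Real.pi / L) ^ 2 * ∫ s in s₀..(s₀ + L), k s ^ 2)) := by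
      apply tendsto_nhdsWithin_of_tendsto_nhds
      exact (Continuous.tendsto (by fun_prop) _)
    refine le_of_tendsto hlim ?_
    filter_upwards [Ioo_mem_nhdsLT (show 0 < Real.pi / L by positivity)] with c hc
    exact h.mul_integral_sq_le hL hc.1 ((lt_div_iff₀ hL).1 hc.2) h0 h1
  have h3 : (L / Real.pi) ^ 2 * (Real.pi / L) ^ 2 = 1 := by field_simp
  have := mul_le_mul_of_nonneg_left h2 (sq_nonneg (L / Real.pi))
  rwa [← mul_assoc, h3, one_mul] at this

end HasBddDerivOffCountable

/-- The integral over one period of a function of period `2π` is invariant under translation. -/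
lemma integral_comp_add_of_periodic {g : ℝ → ℝ} (hg : Function.Periodic g (2 * Real.pi)) (a : ℝ) :
    ∫ s in 0..(2 * Real.pi), g (s + a) = ∫ s in 0..(2 * Real.pi), g s := by
  rw [intervalIntegral.integral_comp_add_right, zero_add, add_comm (2 * Real.pi),
    hg.intervalIntegral_add_eq a 0, zero_add]

open Real in
/-- The sharp bound on the quarter-turn differences of a function on the circle. -/
lemma HasBddDerivOffCountable.integral_sq_quarter_turn_le {k k' : ℝ → ℝ}
    (h : HasBddDerivOffCountable k k') (hk : Function.Periodic k (2 * π))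
    (hk' : Function.Periodic k' (2 * π)) :
    ∫ s in 0..(2 * π), (k (s + π / 2) - k s) ^ 2 ≤ 2 * ∫ s in 0..(2 * π), k' s ^ 2 := by
  have hpi := Real.pi_pos
  have aux : ∀ {f : ℝ → ℝ}, Function.Periodic f (2 * π) → ∀ s, f (s + π / 2 + π / 2) = f (s + π) ∧
      f (s + π + π / 2) = f (s + 3 * π / 2) ∧ f (s + 3 * π / 2 + π / 2) = f s ∧
      f (s + π + π) = f s ∧ f (s + π / 2 + π) = f (s + 3 * π / 2) ∧
      f (s + 3 * π / 2 + π) = f (s + π / 2) := by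
    intro f hf s
    refine ⟨by ring_nf, by ring_nf, ?_, ?_, by ring_nf, ?_⟩
    · rw [← hf s]; ring_nf
    · rw [← hf s]; ring_nf
    · rw [← hf (s + π / 2)]; ring_nf
  set o : (ℝ → ℝ) → ℝ → ℝ := fun f s =>
    1 / 2 * ((f (s + π / 2) - f s) - (f (s + 3 * π / 2) - f (s + π))) with ho
  set e : (ℝ → ℝ) → ℝ → ℝ := fun f s =>
    1 / 2 * ((f (s + π / 2) - f s) + (f (s + 3 * π / 2) - f (s + π))) with he
  have hoD : HasBddDerivOffCountable (o k) (o k') :=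
    ((((h.comp_add_const _).sub h).sub
      ((h.comp_add_const _).sub (h.comp_add_const _))).const_mul _)
  have heD : HasBddDerivOffCountable (e k) (e k') :=
    ((((h.comp_add_const _).sub h).add
      ((h.comp_add_const _).sub (h.comp_add_const _))).const_mul _)
  have oA : ∀ {f : ℝ → ℝ}, Function.Periodic f (2 * π) → ∀ s, o f (s + π) = - o f s := by
    intro f hf s
    obtain ⟨h1, h2, h3, h4, h5, h6⟩ := aux hf s
    have h7 : f (s + π + 3 * π / 2) = f (s + π / 2) := by rw [← h6]; ring_nf
    simp only [ho, h2, h4, h7]; ring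
  have eA : ∀ {f : ℝ → ℝ}, Function.Periodic f (2 * π) → ∀ s, e f (s + π / 2) = - e f s := by
    intro f hf s
    obtain ⟨h1, h2, h3, h4, h5, h6⟩ := aux hf s
    have h7 : f (s + π / 2 + 3 * π / 2) = f s := by rw [← h3]; ring_nf
    simp only [he, h1, h5, h7]; ring
  have w1 := hoD.integral_sq_le_of_antiperiodic hpi (oA hk) (oA hk')
  have w2 := heD.integral_sq_le_of_antiperiodic (L := π / 2) (by positivity) (eA hk) (eA hk')
  have mult : ∀ {g : ℝ → ℝ} {L : ℝ} (m : ℕ), (∀ a b, IntervalIntegrable g volume a b) →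
      Function.Periodic g L → m * L = 2 * π →
      ∫ s in 0..(2 * π), g s = m * ∫ s in 0..L, g s := by
    intro g L m hi hg hm
    have := hg.intervalIntegral_add_zsmul_eq m 0 hi
    simpa [hm] using this
  have pO : ∀ {f : ℝ → ℝ}, Function.Periodic f (2 * π) → Function.Periodic (fun s => o f s ^ 2) π :=
    fun hf s => by simp [oA hf]
  have pE : ∀ {f : ℝ → ℝ}, Function.Periodic f (2 * π) →
      Function.Periodic (fun s => e f s ^ 2) (π / 2) :=
    fun hf s => by simp [eA hf]
  have o1 := mult 2 hoD.sq_intervalIntegrable (pO hk) (by norm_num)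
  have o2 := mult 2 hoD.intervalIntegrable_sq (pO hk') (by norm_num)
  have e1 := mult 4 heD.sq_intervalIntegrable (pE hk) (by push_cast; ring)
  have e2 := mult 4 heD.intervalIntegrable_sq (pE hk') (by push_cast; ring)
  have c1 : (π / π) ^ 2 = 1 := by field_simp
  have c2 : (π / 2 / π) ^ 2 = 1 / 4 := by field_simp; norm_num
  rw [c1] at w1
  rw [c2] at w2
  have hdD := (h.comp_add_const (π / 2)).sub h
  have pd : Function.Periodic (fun s => (k (s + π / 2) - k s) ^ 2) (2 * π) := fun s => by
    have := hk (s + π / 2)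
    simp only [hk s, ← this]; ring_nf
  have s1 := integral_comp_add_of_periodic pd π
  have s2 : ∫ s in 0..(2 * π), ((k (s + π / 2) - k s) ^ 2 +
      (k (s + π + π / 2) - k (s + π)) ^ 2) = 2 * (∫ s in 0..(2 * π), o k s ^ 2) +
      2 * ∫ s in 0..(2 * π), e k s ^ 2 := by
    rw [← intervalIntegral.integral_const_mul, ← intervalIntegral.integral_const_mul,
      ← intervalIntegral.integral_add ((hoD.sq_intervalIntegrable _ _).const_mul _)
        ((heD.sq_intervalIntegrable _ _).const_mul _)]
    congr 1; ext s
    obtain ⟨h1, h2, h3, h4, h5, h6⟩ := aux hk s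
    simp only [ho, he, h2]; ring
  rw [intervalIntegral.integral_add (hdD.sq_intervalIntegrable _ _)
    ((hdD.comp_add_const π).sq_intervalIntegrable _ _), s1] at s2
  have pk : Function.Periodic (fun s => k' s ^ 2) (2 * π) := fun s => by simp [hk' s]
  have t1 := integral_comp_add_of_periodic pk (π / 2)
  have t2 := integral_comp_add_of_periodic pk π
  have t3 := integral_comp_add_of_periodic pk (3 * π / 2)
  have pO2 : Function.Periodic (fun s => o k' s ^ 2) (2 * π) := by
    simpa using (pO hk').nsmul 2
  have t4 := integral_comp_add_of_periodic pO2 (π / 2)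
  have i0 := h.intervalIntegrable_sq 0 (2 * π)
  have i1 := (h.comp_add_const (π / 2)).intervalIntegrable_sq 0 (2 * π)
  have i2 := (h.comp_add_const π).intervalIntegrable_sq 0 (2 * π)
  have i3 := (h.comp_add_const (3 * π / 2)).intervalIntegrable_sq 0 (2 * π)
  have j0 := hoD.intervalIntegrable_sq 0 (2 * π)
  have j1 := (hoD.comp_add_const (π / 2)).intervalIntegrable_sq 0 (2 * π)
  have j2 := heD.intervalIntegrable_sq 0 (2 * π)
  have fin : ∫ s in 0..(2 * π), (2 * (o k' s ^ 2 + o k' (s + π / 2) ^ 2) + e k' s ^ 2) ≤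
      ∫ s in 0..(2 * π), 2 * (k' s ^ 2 + k' (s + π / 2) ^ 2 + k' (s + π) ^ 2 +
        k' (s + 3 * π / 2) ^ 2) := by
    apply intervalIntegral.integral_mono_on (by positivity) (((j0.add j1).const_mul _).add j2)
      ((((i0.add i1).add i2).add i3).const_mul _)
    intro s _
    obtain ⟨h1, h2, h3, h4, h5, h6⟩ := aux hk' s
    have h7 : k' (s + π / 2 + 3 * π / 2) = k' s := by rw [← h3]; ring_nf
    simp only [ho, he, h1, h5, h7]
    nlinarith [sq_nonneg (k' s + k' (s + π)), sq_nonneg (k' (s + π / 2) + k' (s + 3 * π / 2)),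
      sq_nonneg (k' s + k' (s + π) + k' (s + π / 2) + k' (s + 3 * π / 2))]
  rw [intervalIntegral.integral_add ((j0.add j1).const_mul _) j2,
    intervalIntegral.integral_const_mul, intervalIntegral.integral_const_mul,
    intervalIntegral.integral_add j0 j1, intervalIntegral.integral_add ((i0.add i1).add i2) i3,
    intervalIntegral.integral_add (i0.add i1) i2, intervalIntegral.integral_add i0 i1,
    t1, t2, t3, t4] at fin
  push_cast at o1 o2 e1 e2
  linarith

section GaussianPoincare

open ProbabilityTheory ContinuousLinearMap

variable {E : Type*} [NormedAddCommGroup E] [InnerProductSpace ℝ E] [FiniteDimensional ℝ E]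
  [MeasurableSpace E] [BorelSpace E]

lemma integral_inner_sq_stdGaussian (v : E) :
    ∫ y, (inner ℝ v y) ^ 2 ∂(stdGaussian E) = ‖v‖ ^ 2 := by
  have h1 := variance_dual_stdGaussian (E := E) (innerSL ℝ v)
  rw [variance_of_integral_eq_zero (by fun_prop) (integral_strongDual_stdGaussian _)] at h1
  simpa using h1

lemma integrable_norm_pow_stdGaussian (k : ℕ) :
    Integrable (fun x : E => ‖x‖ ^ k) (stdGaussian E) := by
  rcases eq_or_ne k 0 with rfl | hk
  · simp
  · exact (IsGaussian.memLp_id (stdGaussian E) k (by simp)).integrable_norm_pow hk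

omit [FiniteDimensional ℝ E] [MeasurableSpace E] [BorelSpace E] in
lemma norm_rotation_le (s : ℝ) (p : E × E) :
    ‖(rotation s p).1‖ ≤ ‖p.1‖ + ‖p.2‖ ∧ ‖(rotation s p).2‖ ≤ ‖p.1‖ + ‖p.2‖ := by
  have hc := Real.abs_cos_le_one s
  have hs := Real.abs_sin_le_one s
  have h1 := norm_nonneg p.1
  have h2 := norm_nonneg p.2
  simp only [ContinuousLinearMap.rotation_apply]
  constructor
  all_goals
    refine (norm_add_le _ _).trans ?_
    simp only [norm_smul, Real.norm_eq_abs, abs_neg]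
    nlinarith

lemma measurable_rotation_comp {Ψ : E × E → ℝ} (hm : Measurable Ψ) :
    Measurable (fun q : (E × E) × ℝ => Ψ (rotation q.2 q.1)) := by
  apply hm.comp
  simp only [ContinuousLinearMap.rotation_apply]
  fun_prop

lemma integrable_of_abs_le_norm_sq {Ψ : E × E → ℝ} {K : ℝ} (hm : Measurable Ψ)
    (hb : ∀ p, |Ψ p| ≤ K * (‖p.1‖ ^ 2 + ‖p.2‖ ^ 2)) :
    Integrable Ψ ((stdGaussian E).prod (stdGaussian E)) := by
  have h := integrable_norm_pow_stdGaussian (E := E) 2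
  refine (((h.comp_fst (stdGaussian E)).add (h.comp_snd (stdGaussian E))).const_mul K).mono'
    hm.aestronglyMeasurable (ae_of_all _ hb)

/-- Averaging over all rotations does not change the integral against a Gaussian product. -/
lemma integral_rotation_average {Ψ : E × E → ℝ} {K : ℝ} (hm : Measurable Ψ)
    (hb : ∀ p, |Ψ p| ≤ K * (‖p.1‖ ^ 2 + ‖p.2‖ ^ 2)) :
    Integrable (fun p => ∫ s in 0..(2 * Real.pi), Ψ (rotation s p))
      ((stdGaussian E).prod (stdGaussian E)) ∧
    ∫ p, (∫ s in 0..(2 * Real.pi), Ψ (rotation s p)) ∂((stdGaussian E).prod (stdGaussian E)) =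
      2 * Real.pi * ∫ p, Ψ p ∂((stdGaussian E).prod (stdGaussian E)) := by
  set M := (stdGaussian E).prod (stdGaussian E) with hM
  set ν := (volume : Measure ℝ).restrict (Set.Ioc 0 (2 * Real.pi)) with hν
  have hpi := Real.pi_pos
  have hmR := measurable_rotation_comp hm
  have h := integrable_norm_pow_stdGaussian (E := E) 2
  have hintg : Integrable (fun q : (E × E) × ℝ => Ψ (rotation q.2 q.1)) (M.prod ν) := by
    refine (((((h.comp_fst (stdGaussian E)).add
      (h.comp_snd (stdGaussian E))).const_mul (4 * |K|)).comp_fst ν)).mono'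
      hmR.aestronglyMeasurable (ae_of_all _ fun q => ?_)
    obtain ⟨h1, h2⟩ := norm_rotation_le q.2 q.1
    rw [Real.norm_eq_abs]
    refine (hb _).trans ?_
    have h3 := norm_nonneg q.1.1
    have h4 := norm_nonneg q.1.2
    have e1 := pow_le_pow_left₀ (norm_nonneg _) h1 2
    have e2 := pow_le_pow_left₀ (norm_nonneg _) h2 2
    have e3 : (‖q.1.1‖ + ‖q.1.2‖) ^ 2 ≤ 2 * (‖q.1.1‖ ^ 2 + ‖q.1.2‖ ^ 2) := by
      nlinarith [sq_nonneg (‖q.1.1‖ - ‖q.1.2‖)]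
    simp only [Pi.add_apply]
    calc K * (‖(rotation q.2 q.1).1‖ ^ 2 + ‖(rotation q.2 q.1).2‖ ^ 2)
        ≤ |K| * (‖(rotation q.2 q.1).1‖ ^ 2 + ‖(rotation q.2 q.1).2‖ ^ 2) := by
          gcongr; exact le_abs_self K
      _ ≤ |K| * (4 * (‖q.1.1‖ ^ 2 + ‖q.1.2‖ ^ 2)) := by gcongr; linarith
      _ = _ := by ring
  have hrot : ∀ s : ℝ, ∫ p, Ψ (rotation s p) ∂M = ∫ p, Ψ p ∂M := by
    intro s
    conv_rhs => rw [hM, ← IsGaussian.map_rotation_eq_self (μ := stdGaussian E) (by simp) s]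
    rw [integral_map (by fun_prop) hm.aestronglyMeasurable]
  simp only [intervalIntegral.integral_of_le (show (0:ℝ) ≤ 2 * Real.pi by positivity)]
  refine ⟨hintg.integral_prod_left, ?_⟩
  rw [integral_integral_swap hintg]
  simp only [hrot]
  simp [hpi.le]

omit [FiniteDimensional ℝ E] [MeasurableSpace E] [BorelSpace E] in
lemma countable_setOf_rotation_fst_eq_zero {p : E × E} (hp : p ≠ 0) :
    {s : ℝ | (rotation s p).1 = 0}.Countable := by
  obtain ⟨v, hv⟩ : ∃ v : E, (⟨inner ℝ v p.1, inner ℝ v p.2⟩ : ℂ) ≠ 0 := by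
    by_contra! h
    apply hp
    ext
    · simpa using congrArg Complex.re (h p.1)
    · simpa using congrArg Complex.im (h p.2)
  set z : ℂ := ⟨inner ℝ v p.1, inner ℝ v p.2⟩ with hz
  refine (Set.countable_range fun k : ℤ => z.arg + (2 * k + 1) * Real.pi / 2).mono ?_
  intro s hs
  have h1 : inner ℝ v (Real.cos s • p.1 + Real.sin s • p.2) = 0 := by
    have : Real.cos s • p.1 + Real.sin s • p.2 = 0 := hs
    simp [this]
  rw [inner_add_right, inner_smul_right, inner_smul_right] at h1
  have h2 : ‖z‖ * Real.cos (s - z.arg) = 0 := by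
    have e1 := Complex.norm_mul_cos_arg z
    have e2 := Complex.norm_mul_sin_arg z
    simp only [hz] at e1 e2
    rw [Real.cos_sub]
    simp only [hz]
    linear_combination h1 + Real.cos s * e1 + Real.sin s * e2
  rcases mul_eq_zero.1 h2 with h3 | h3
  · exact absurd (norm_eq_zero.1 h3) hv
  · obtain ⟨k, hk⟩ := Real.cos_eq_zero_iff.1 h3
    exact ⟨k, by simp only; linarith⟩

/-- The Gaussian Poincaré inequality, for a function that may fail to be differentiable at `0`. -/
lemma integral_sq_le_integral_norm_gradient_sq_stdGaussian {h : E → ℝ} {G : E → E} {C : ℝ}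
    (hc : Continuous h) (hG : Measurable G) (hC : ∀ x, ‖G x‖ ≤ C) (hb : ∀ x, |h x| ≤ C * ‖x‖)
    (hd : ∀ x ≠ 0, HasGradientAt h (G x) x) (h0 : ∫ x, h x ∂(stdGaussian E) = 0) :
    ∫ x, h x ^ 2 ∂(stdGaussian E) ≤ ∫ x, ‖G x‖ ^ 2 ∂(stdGaussian E) := by
  have hC0 : 0 ≤ C := (norm_nonneg _).trans (hC 0)
  have hpi := Real.pi_pos
  set γ := stdGaussian E with hγ
  set Ψ₁ : E × E → ℝ := fun p => (h p.2 - h p.1) ^ 2 with hΨ₁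
  set Ψ₂ : E × E → ℝ := fun p => (inner ℝ (G p.1) p.2) ^ 2 with hΨ₂
  have m1 : Measurable Ψ₁ := by fun_prop
  have m2 : Measurable Ψ₂ := by
    have : Measurable fun p : E × E => inner ℝ (G p.1) p.2 :=
      (hG.comp measurable_fst).inner measurable_snd
    exact this.pow_const 2
  have hsq : ∀ x, h x ^ 2 ≤ C ^ 2 * ‖x‖ ^ 2 := fun x => by
    rw [← sq_abs, ← mul_pow]; exact pow_le_pow_left₀ (abs_nonneg _) (hb x) 2
  have b1 : ∀ p, |Ψ₁ p| ≤ (2 * C ^ 2) * (‖p.1‖ ^ 2 + ‖p.2‖ ^ 2) := fun p => by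
    rw [abs_of_nonneg (sq_nonneg _)]
    nlinarith [hsq p.1, hsq p.2, sq_nonneg (h p.1 + h p.2)]
  have b2 : ∀ p, |Ψ₂ p| ≤ C ^ 2 * (‖p.1‖ ^ 2 + ‖p.2‖ ^ 2) := fun p => by
    rw [abs_of_nonneg (sq_nonneg _)]
    have e1 : |inner ℝ (G p.1) p.2| ≤ C * ‖p.2‖ :=
      (abs_real_inner_le_norm _ _).trans (by gcongr; exact hC _)
    have e2 := pow_le_pow_left₀ (abs_nonneg _) e1 2
    rw [sq_abs] at e2
    simp only [hΨ₂]
    nlinarith [mul_nonneg (sq_nonneg C) (sq_nonneg ‖p.1‖)]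
  obtain ⟨i1, e1⟩ := integral_rotation_average m1 b1
  obtain ⟨i2, e2⟩ := integral_rotation_average m2 b2
  have rot : ∀ (p : E × E) (s : ℝ), (rotation (s + Real.pi / 2) p).1 = (rotation s p).2 := by
    intro p s
    simp [ContinuousLinearMap.rotation_apply, Real.cos_add_pi_div_two, Real.sin_add_pi_div_two]
  have per : ∀ (p : E × E) (s : ℝ), rotation (s + 2 * Real.pi) p = rotation s p := by
    intro p s
    simp [ContinuousLinearMap.rotation_apply]
  have hcirc : ∀ p : E × E, HasBddDerivOffCountable (fun s => h (rotation s p).1)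
      (fun s => inner ℝ (G (rotation s p).1) (rotation s p).2) := by
    intro p
    have hcr : Continuous fun s => (rotation s p).1 := by
      simp only [ContinuousLinearMap.rotation_apply]; fun_prop
    have hcr2 : Continuous fun s => (rotation s p).2 := by
      simp only [ContinuousLinearMap.rotation_apply]; fun_prop
    refine ⟨by fun_prop, (hG.comp hcr.measurable).inner hcr2.measurable,
      ⟨C * (‖p.1‖ + ‖p.2‖), fun s => (abs_real_inner_le_norm _ _).trans
        (mul_le_mul (hC _) (norm_rotation_le s p).2 (norm_nonneg _) hC0)⟩, ?_⟩
    rcases eq_or_ne p 0 with rfl | hp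
    · refine ⟨∅, Set.countable_empty, fun s _ => ?_⟩
      simp only [map_zero, Prod.fst_zero, Prod.snd_zero, inner_zero_right]
      exact hasDerivAt_const _ _
    · refine ⟨_, countable_setOf_rotation_fst_eq_zero hp, fun s hs => ?_⟩
      have hr : HasDerivAt (fun s => (rotation s p).1) (rotation s p).2 s := by
        simp only [ContinuousLinearMap.rotation_apply]
        exact ((Real.hasDerivAt_cos s).smul_const p.1).add
          ((Real.hasDerivAt_sin s).smul_const p.2)
      have := (hd _ hs).hasFDerivAt.comp_hasDerivAt s hr
      exact this.congr_deriv (by simp)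
  have hpt : ∀ p : E × E, ∫ s in 0..(2 * Real.pi), Ψ₁ (rotation s p) ≤
      2 * ∫ s in 0..(2 * Real.pi), Ψ₂ (rotation s p) := by
    intro p
    have := (hcirc p).integral_sq_quarter_turn_le (fun s => by simp [per]) (fun s => by simp [per])
    simpa only [rot] using this
  have hfin := integral_mono i1 (i2.const_mul 2) hpt
  rw [integral_const_mul, e1, e2] at hfin
  have ih : Integrable h γ :=
    ((integrable_norm_pow_stdGaussian (E := E) 1).const_mul C).mono' hc.aestronglyMeasurable
      (ae_of_all _ fun x => by simpa using hb x)
  have ih2 : Integrable (fun x => h x ^ 2) γ :=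
    ((integrable_norm_pow_stdGaussian (E := E) 2).const_mul (C ^ 2)).mono'
      (hc.pow 2).aestronglyMeasurable
      (ae_of_all _ fun x => by rw [Real.norm_of_nonneg (sq_nonneg _)]; exact hsq x)
  have v1 : ∫ p, Ψ₁ p ∂(γ.prod γ) = 2 * ∫ x, h x ^ 2 ∂γ := by
    have : ∀ p : E × E, Ψ₁ p = h p.1 ^ 2 + h p.2 ^ 2 - 2 * (h p.1 * h p.2) := fun p => by
      simp only [hΨ₁]; ring
    simp only [this]
    have i12 : Integrable (fun p : E × E => h p.1 ^ 2 + h p.2 ^ 2) (γ.prod γ) :=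
      (ih2.comp_fst γ).add (ih2.comp_snd γ)
    rw [integral_sub i12 ((ih.mul_prod ih).const_mul 2),
      integral_add (ih2.comp_fst γ) (ih2.comp_snd γ), integral_const_mul,
      integral_prod_mul, h0, integral_fun_fst (fun x => h x ^ 2),
      integral_fun_snd (fun x => h x ^ 2)]
    simp [hγ]
    ring
  have v2 : ∫ p, Ψ₂ p ∂(γ.prod γ) = ∫ x, ‖G x‖ ^ 2 ∂γ := by
    rw [integral_prod _ (integrable_of_abs_le_norm_sq m2 b2)]
    simp only [hΨ₂, hγ, integral_inner_sq_stdGaussian]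
  rw [v1, v2] at hfin
  nlinarith

end GaussianPoincare

section SphereUniqueness

variable {E : Type*} [NormedAddCommGroup E] [InnerProductSpace ℝ E]

lemma exists_linearIsometryEquiv_apply_eq [FiniteDimensional ℝ E] {x y : E} (h : ‖x‖ = ‖y‖) :
    ∃ e : E ≃ₗᵢ[ℝ] E, e x = y :=
  ⟨_, Submodule.reflection_sub h⟩

/-- A measure on `E` that is concentrated on the unit sphere and invariant under all linear
isometries. -/
structure IsRotationInvariantOnSphere [MeasurableSpace E] (μ : Measure E) : Prop where
  ae_norm_eq_one : ∀ᵐ x ∂μ, ‖x‖ = 1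
  map_eq : ∀ e : E ≃ₗᵢ[ℝ] E, μ.map e = μ

variable [FiniteDimensional ℝ E] [MeasurableSpace E] [BorelSpace E]

namespace IsRotationInvariantOnSphere

variable {μ ν : Measure E}

omit [FiniteDimensional ℝ E] in
lemma integral_comp (hμ : IsRotationInvariantOnSphere μ) (e : E ≃ₗᵢ[ℝ] E) (f : E → ℝ) :
    ∫ x, f (e x) ∂μ = ∫ x, f x ∂μ := by
  conv_rhs => rw [← hμ.map_eq e]
  exact (e.toHomeomorph.measurableEmbedding.integral_map f).symm

lemma integral_kernel_eq (hμ : IsRotationInvariantOnSphere μ) (K : ℝ → ℝ) {y z : E}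
    (h : ‖y‖ = ‖z‖) : ∫ x, K ‖x - y‖ ∂μ = ∫ x, K ‖x - z‖ ∂μ := by
  obtain ⟨e, rfl⟩ := exists_linearIsometryEquiv_apply_eq h
  rw [← hμ.integral_comp e fun x => K ‖x - e y‖]
  simp only [← map_sub, LinearIsometryEquiv.norm_map]

lemma integral_kernel_pos [IsFiniteMeasure μ] (hμ : IsRotationInvariantOnSphere μ) (h0 : μ ≠ 0)
    {δ : ℝ} (hδ : 0 < δ) {y : E} (hy : ‖y‖ = 1) : 0 < ∫ x, max 0 (δ - ‖x - y‖) ∂μ := by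
  have hintg : ∀ y : E, Integrable (fun x => max 0 (δ - ‖x - y‖)) μ := fun y =>
    (integrable_const δ).mono' (by fun_prop) (ae_of_all _ fun x => by
      rw [Real.norm_of_nonneg (le_max_left _ _)]
      exact max_le hδ.le (by linarith [norm_nonneg (x - y)]))
  refine lt_of_le_of_ne (integral_nonneg fun x => le_max_left _ _) fun h => h0 ?_
  have hball : ∀ z : E, ‖z‖ = 1 → μ (Metric.ball z δ) = 0 := by
    intro z hz
    have h1 : ∫ x, max 0 (δ - ‖x - z‖) ∂μ = 0 := by
      rw [hμ.integral_kernel_eq (fun t => max 0 (δ - t)) (hz.trans hy.symm)]; exact h.symm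
    replace h1 := (integral_eq_zero_iff_of_nonneg (fun x => le_max_left 0 (δ - ‖x - z‖))
      (hintg z)).1 h1
    refine measure_mono_null (fun x hx => ?_) h1
    rw [Metric.mem_ball, dist_eq_norm] at hx
    simp only [Set.mem_compl_iff, Set.mem_ofPred_eq, Pi.zero_apply, max_eq_left_iff, not_le]
    linarith
  have hsph : μ (Metric.sphere 0 1) = 0 :=
    (isCompact_sphere (0 : E) 1).measure_zero_of_nhdsWithin fun z hz =>
      ⟨_, mem_nhdsWithin_of_mem_nhds (Metric.ball_mem_nhds z hδ), hball z (by simpa using hz)⟩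
  rw [← Measure.measure_univ_eq_zero]
  have hc : μ (Metric.sphere 0 1)ᶜ = 0 := by
    have := hμ.ae_norm_eq_one
    rw [ae_iff] at this
    convert this using 2
    ext x; simp
  rw [← Set.union_compl_self (Metric.sphere (0 : E) 1)]
  exact measure_union_null hsph hc

lemma real_univ_mul_integral_eq [IsFiniteMeasure μ] [IsFiniteMeasure ν]
    (hμ : IsRotationInvariantOnSphere μ) (hν : IsRotationInvariantOnSphere ν) (hμ0 : μ ≠ 0)
    (f : BoundedContinuousFunction E ℝ) :
    ν.real Set.univ * ∫ x, f x ∂μ = μ.real Set.univ * ∫ x, f x ∂ν := by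
  obtain ⟨y₀, hy₀⟩ : ∃ y : E, ‖y‖ = 1 := by
    have : (ae μ).NeBot := ae_neBot.2 hμ0
    exact hμ.ae_norm_eq_one.exists
  have hunif : UniformContinuousOn f (Metric.sphere 0 1) :=
    (isCompact_sphere (0 : E) 1).uniformContinuousOn_of_continuous f.continuous.continuousOn
  rw [Metric.uniformContinuousOn_iff] at hunif
  rw [← sub_eq_zero, ← abs_nonpos_iff]
  refine le_of_forall_pos_le_add fun ω' hω' => ?_
  set a := μ.real Set.univ with ha
  set b := ν.real Set.univ with hb
  have ha0 : 0 ≤ a := measureReal_nonneg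
  have hb0 : 0 ≤ b := measureReal_nonneg
  set ω := ω' / (a * b + 1) with hωdef
  have hω : 0 < ω := by positivity
  obtain ⟨δ, hδ, hclose⟩ := hunif ω hω
  set k : E → E → ℝ := fun x y => max 0 (δ - ‖x - y‖) with hk
  have hk0 : ∀ x y, 0 ≤ k x y := fun x y => le_max_left _ _
  have hkδ : ∀ x y, k x y ≤ δ := fun x y => max_le hδ.le (by linarith [norm_nonneg (x - y)])
  set g := ∫ x, k x y₀ ∂μ with hg
  set h := ∫ x, k x y₀ ∂ν with hh
  have hgpos : 0 < g := hμ.integral_kernel_pos hμ0 hδ hy₀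
  have hgy : ∀ y : E, ‖y‖ = 1 → ∫ x, k x y ∂μ = g := fun y hy =>
    hμ.integral_kernel_eq (fun t => max 0 (δ - t)) (hy.trans hy₀.symm)
  have hhx : ∀ x : E, ‖x‖ = 1 → ∫ y, k x y ∂ν = h := fun x hx => by
    simp only [hk, norm_sub_rev x]
    exact hν.integral_kernel_eq (fun t => max 0 (δ - t)) (hx.trans hy₀.symm)
  have hkc : Continuous fun p : E × E => k p.1 p.2 := by fun_prop
  have hki : Integrable (fun p : E × E => k p.1 p.2) (μ.prod ν) :=
    (integrable_const δ).mono' hkc.aestronglyMeasurable (ae_of_all _ fun p => by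
      rw [Real.norm_of_nonneg (hk0 _ _)]; exact hkδ _ _)
  have hkf1 : Integrable (fun p : E × E => k p.1 p.2 * f p.1) (μ.prod ν) :=
    hki.mul_bdd (c := ‖f‖) (by fun_prop) (ae_of_all _ fun p => f.norm_coe_le_norm _)
  have hkf2 : Integrable (fun p : E × E => k p.1 p.2 * f p.2) (μ.prod ν) :=
    hki.mul_bdd (c := ‖f‖) (by fun_prop) (ae_of_all _ fun p => f.norm_coe_le_norm _)
  have I1 : ∫ p, k p.1 p.2 * f p.1 ∂(μ.prod ν) = h * ∫ x, f x ∂μ := by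
    rw [integral_prod _ hkf1, ← integral_const_mul]
    refine integral_congr_ae ?_
    filter_upwards [hμ.ae_norm_eq_one] with x hx
    simp only [integral_mul_const, hhx x hx]
  have I2 : ∫ p, k p.1 p.2 * f p.2 ∂(μ.prod ν) = g * ∫ x, f x ∂ν := by
    rw [integral_prod_symm _ hkf2, ← integral_const_mul]
    refine integral_congr_ae ?_
    filter_upwards [hν.ae_norm_eq_one] with x hx
    simp only [integral_mul_const, hgy x hx]
  have J1 : ∫ p, k p.1 p.2 ∂(μ.prod ν) = h * a := by
    rw [integral_prod _ hki, integral_congr_ae (g := fun _ => h)]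
    · simp [ha, mul_comm]
    · filter_upwards [hμ.ae_norm_eq_one] with x hx using hhx x hx
  have J2 : ∫ p, k p.1 p.2 ∂(μ.prod ν) = g * b := by
    rw [integral_prod_symm _ hki, integral_congr_ae (g := fun _ => g)]
    · simp [hb, mul_comm]
    · filter_upwards [hν.ae_norm_eq_one] with x hx using hgy x hx
  have hae : ∀ᵐ p ∂(μ.prod ν), ‖p.1‖ = 1 ∧ ‖p.2‖ = 1 :=
    (Measure.quasiMeasurePreserving_fst.ae hμ.ae_norm_eq_one).and
      (Measure.quasiMeasurePreserving_snd.ae hν.ae_norm_eq_one)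
  have key : |h * ∫ x, f x ∂μ - g * ∫ x, f x ∂ν| ≤ ω * (g * b) := by
    rw [← I1, ← I2, ← integral_sub hkf1 hkf2, ← J2, ← integral_const_mul]
    rw [← Real.norm_eq_abs]
    refine norm_integral_le_of_norm_le (hki.const_mul ω) ?_
    filter_upwards [hae] with p hp
    rw [← mul_sub, norm_mul, Real.norm_of_nonneg (hk0 _ _), mul_comm]
    by_cases hd : ‖p.1 - p.2‖ < δ
    · have := hclose p.1 (by simpa using hp.1) p.2 (by simpa using hp.2)
        (by rwa [dist_eq_norm])
      rw [dist_eq_norm] at this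
      exact mul_le_mul_of_nonneg_right this.le (hk0 _ _)
    · have : k p.1 p.2 = 0 := max_eq_left (by linarith)
      simp [this]
  have hag : h * a = g * b := J1.symm.trans J2
  have key2 : g * |b * ∫ x, f x ∂μ - a * ∫ x, f x ∂ν| ≤ g * (ω * (a * b)) := by
    have e : g * (b * ∫ x, f x ∂μ - a * ∫ x, f x ∂ν) =
        a * (h * ∫ x, f x ∂μ - g * ∫ x, f x ∂ν) := by
      linear_combination - (∫ x, f x ∂μ) * hag
    rw [← abs_of_pos hgpos, ← abs_mul, abs_of_pos hgpos, e, abs_mul, abs_of_nonneg ha0]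
    calc _ ≤ a * (ω * (g * b)) := by gcongr
      _ = _ := by ring
  have key3 := le_of_mul_le_mul_left key2 hgpos
  have : ω * (a * b) ≤ ω' := by
    rw [hωdef, div_mul_eq_mul_div, div_le_iff₀ (by positivity)]
    nlinarith
  linarith

/-- Rotation invariant finite measures on the sphere are unique up to a constant. -/
lemma eq_smul [IsFiniteMeasure μ] [IsFiniteMeasure ν]
    (hμ : IsRotationInvariantOnSphere μ) (hν : IsRotationInvariantOnSphere ν) (hμ0 : μ ≠ 0) :
    ν = (ν Set.univ / μ Set.univ) • μ := by
  have h0 : μ Set.univ ≠ 0 := by simpa using hμ0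
  have hfin : ν Set.univ / μ Set.univ ≠ ⊤ := ENNReal.div_ne_top (measure_ne_top _ _) h0
  have : IsFiniteMeasure ((ν Set.univ / μ Set.univ) • μ) := μ.smul_finite hfin
  refine ext_of_forall_integral_eq_of_IsFiniteMeasure fun f => ?_
  rw [integral_smul_measure, ENNReal.toReal_div, smul_eq_mul]
  have := hμ.real_univ_mul_integral_eq hν hμ0 f
  have h1 : μ.real Set.univ ≠ 0 := (measureReal_ne_zero_iff (measure_ne_top _ _)).2 h0
  simp only [Measure.real] at this h1
  field_simp
  linarith

end IsRotationInvariantOnSphere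

end SphereUniqueness

section UnitSphereMeasure

open scoped Pointwise

lemma lipschitzOnWith_inv_norm_smul {E : Type*} [NormedAddCommGroup E] [NormedSpace ℝ E] :
    LipschitzOnWith 2 (fun x : E => ‖x‖⁻¹ • x) {x | 1 ≤ ‖x‖} := by
  refine LipschitzOnWith.of_dist_le_mul fun x hx y hy => ?_
  rw [dist_eq_norm, dist_eq_norm]
  have hx : 1 ≤ ‖x‖ := hx
  have hy : 1 ≤ ‖y‖ := hy
  have hx0 : 0 < ‖x‖ := by linarith
  have hy0 : 0 < ‖y‖ := by linarith
  have e : ‖x‖⁻¹ • x - ‖y‖⁻¹ • y = ‖x‖⁻¹ • (x - y) + ((‖y‖ - ‖x‖) / ‖x‖ * ‖y‖⁻¹) • y := by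
    rw [smul_sub, sub_add, ← sub_smul]
    congr 2
    field_simp
    ring
  have h1 : ‖x‖⁻¹ ≤ 1 := inv_le_one_of_one_le₀ hx
  have h2 : |‖y‖ - ‖x‖| ≤ ‖x - y‖ := by rw [norm_sub_rev]; exact abs_norm_sub_norm_le y x
  rw [e]
  refine (norm_add_le _ _).trans ?_
  rw [norm_smul, norm_smul, norm_mul, norm_div, norm_inv, norm_inv, norm_norm, norm_norm,
    Real.norm_eq_abs, div_eq_mul_inv, mul_assoc, inv_mul_cancel₀ hy0.ne', mul_one]
  have h3 : ‖x‖⁻¹ * ‖x - y‖ ≤ 1 * ‖x - y‖ := by gcongr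
  have h4 : |‖y‖ - ‖x‖| * ‖x‖⁻¹ ≤ ‖x - y‖ * 1 := by gcongr
  simp only [NNReal.coe_ofNat]
  linarith

lemma hausdorffMeasure_sphere_lt_top (m : ℕ) :
    μH[(m : ℝ)] (Metric.sphere (0 : EuclideanSpace ℝ (Fin (m + 1))) 1) < ⊤ := by
  set ψ : Fin (m + 1) → ℝ → (Fin m → ℝ) → EuclideanSpace ℝ (Fin (m + 1)) := fun i s x =>
    WithLp.toLp 2 (i.insertNth s x) with hψ
  set Q : Set (Fin m → ℝ) := Set.Icc (fun _ => -1) (fun _ => 1) with hQ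
  set P : EuclideanSpace ℝ (Fin (m + 1)) → EuclideanSpace ℝ (Fin (m + 1)) :=
    fun x => ‖x‖⁻¹ • x with hP
  have hcov : Metric.sphere (0 : EuclideanSpace ℝ (Fin (m + 1))) 1 ⊆
      ⋃ i : Fin (m + 1), (P '' (ψ i 1 '' Q) ∪ P '' (ψ i (-1) '' Q)) := by
    intro x hx
    have hx : ‖x‖ = 1 := by simpa using hx
    obtain ⟨i, hi⟩ := Finite.exists_max fun i => |x i|
    have hpos : 0 < |x i| := by
      rcases (abs_nonneg (x i)).lt_or_eq with h | h
      · exact h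
      · exfalso
        have : x = 0 := by
          ext j
          have := hi j
          rw [← h] at this
          simpa using this
        simp [this] at hx
    have hmem : ∀ s : ℝ, |x i| * s = x i →
        ∃ y ∈ Q, P (ψ i s y) = x := by
      intro s hs
      refine ⟨fun j => |x i|⁻¹ * x (i.succAbove j), ?_, ?_⟩
      · have : ∀ j, |(|x i|⁻¹ * x j)| ≤ 1 := fun j => by
          rw [abs_mul, abs_inv, abs_abs, inv_mul_le_iff₀ hpos, mul_one]; exact hi j
        exact ⟨fun j => (abs_le.1 (this _)).1, fun j => (abs_le.1 (this _)).2⟩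
      · have : ψ i s (fun j => |x i|⁻¹ * x (i.succAbove j)) = |x i|⁻¹ • x := by
          ext j
          refine Fin.succAboveCases i ?_ (fun j => ?_) j
          · simp only [hψ, Fin.insertNth_apply_same, PiLp.smul_apply, smul_eq_mul]
            rw [eq_inv_mul_iff_mul_eq₀ hpos.ne', hs]
          · simp [hψ]
        rw [this]
        simp only [hP, norm_smul, hx, norm_inv, Real.norm_eq_abs, abs_abs, mul_one,
          inv_inv, smul_smul]
        rw [mul_inv_cancel₀ hpos.ne', one_smul]
    rw [Set.mem_iUnion]
    refine ⟨i, ?_⟩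
    rcases abs_cases (x i) with h | h
    · obtain ⟨y, hy, hy2⟩ := hmem 1 (by rw [h.1, mul_one])
      exact Or.inl ⟨_, ⟨y, hy, rfl⟩, hy2⟩
    · obtain ⟨y, hy, hy2⟩ := hmem (-1) (by rw [h.1]; ring)
      exact Or.inr ⟨_, ⟨y, hy, rfl⟩, hy2⟩
  have hface : ∀ i : Fin (m + 1), ∀ s : ℝ, |s| = 1 → μH[(m : ℝ)] (P '' (ψ i s '' Q)) < ⊤ := by
    intro i s hs
    have hins : LipschitzWith 1 fun x : Fin m → ℝ => (i.insertNth s x : Fin (m + 1) → ℝ) := by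
      refine LipschitzWith.of_dist_le_mul fun x y => ?_
      rw [NNReal.coe_one, one_mul, dist_pi_le_iff dist_nonneg]
      intro j
      refine Fin.succAboveCases i ?_ (fun j => ?_) j
      · simp
      · simpa using dist_le_pi_dist x y j
    have hL := (PiLp.lipschitzWith_toLp 2 (fun _ : Fin (m + 1) => ℝ)).comp hins
    have h1 : 1 ≤ ‖ψ i s 0‖ ∧ ∀ x, 1 ≤ ‖ψ i s x‖ := by
      have : ∀ x, 1 ≤ ‖ψ i s x‖ := fun x => by
        have := PiLp.norm_apply_le (ψ i s x) i
        simpa [hψ, hs] using this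
      exact ⟨this 0, this⟩
    have hP2 : LipschitzOnWith 2 P (ψ i s '' Q) :=
      lipschitzOnWith_inv_norm_smul.mono (by rintro _ ⟨x, -, rfl⟩; exact h1.2 x)
    refine (hP2.hausdorffMeasure_image_le (Nat.cast_nonneg m)).trans_lt
      (ENNReal.mul_lt_top (by simp) ?_)
    refine ((hL.hausdorffMeasure_image_le (Nat.cast_nonneg m) Q)).trans_lt
      (ENNReal.mul_lt_top (ENNReal.rpow_lt_top_of_nonneg (Nat.cast_nonneg m) (by simp)) ?_)
    have := hausdorffMeasure_pi_real (ι := Fin m)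
    rw [Fintype.card_fin] at this
    rw [this]
    exact isCompact_Icc.measure_lt_top
  refine (measure_mono hcov).trans_lt ?_
  refine (measure_iUnion_le _).trans_lt ?_
  rw [tsum_fintype, ENNReal.sum_lt_top]
  exact fun i _ => measure_union_lt_top (hface i 1 (by simp)) (hface i (-1) (by simp))

lemma hausdorffMeasure_sphere_pos (m : ℕ) :
    0 < μH[(m : ℝ)] (Metric.sphere (0 : EuclideanSpace ℝ (Fin (m + 1))) 1) := by
  set π : EuclideanSpace ℝ (Fin (m + 1)) → Fin m → ℝ := fun x j => x j.succ with hπ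
  have hL : LipschitzWith 1 π := by
    refine LipschitzWith.of_dist_le_mul fun x y => ?_
    rw [NNReal.coe_one, one_mul, dist_pi_le_iff dist_nonneg]
    intro j
    rw [dist_eq_norm, dist_eq_norm]
    exact PiLp.norm_apply_le (x - y) j.succ
  have hsub : {y : Fin m → ℝ | ∑ j, y j ^ 2 < 1} ⊆ π '' Metric.sphere 0 1 := by
    intro y hy
    have hy : ∑ j, y j ^ 2 < 1 := hy
    refine ⟨WithLp.toLp 2 (Fin.cons (Real.sqrt (1 - ∑ j, y j ^ 2)) y), ?_, ?_⟩
    · rw [mem_sphere_zero_iff_norm, EuclideanSpace.norm_eq, Real.sqrt_eq_one, Fin.sum_univ_succ]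
      simp only [Fin.cons_zero, Fin.cons_succ, Real.norm_eq_abs, sq_abs]
      rw [Real.sq_sqrt (by linarith)]
      ring
    · ext j; simp [hπ]
  have hopen : IsOpen {y : Fin m → ℝ | ∑ j, y j ^ 2 < 1} :=
    isOpen_lt (by fun_prop) continuous_const
  have hpos := hopen.measure_pos volume ⟨0, by simp⟩
  have h1 := hausdorffMeasure_pi_real (ι := Fin m)
  rw [Fintype.card_fin] at h1
  rw [← h1] at hpos
  refine (hpos.trans_le (measure_mono hsub)).trans_le ?_
  refine (hL.hausdorffMeasure_image_le (Nat.cast_nonneg m) _).trans ?_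
  simp

/-- Surface measure on the unit sphere of `ℝ^(m+1)`. -/
noncomputable def unitSphereMeasure (m : ℕ) : Measure (EuclideanSpace ℝ (Fin (m + 1))) :=
  (μH[(m : ℝ)]).restrict (Metric.sphere 0 1)

variable {m : ℕ}

instance : IsFiniteMeasure (unitSphereMeasure m) :=
  ⟨by simpa [unitSphereMeasure] using hausdorffMeasure_sphere_lt_top m⟩

lemma unitSphereMeasure_ne_zero : unitSphereMeasure m ≠ 0 := by
  rw [← Measure.measure_univ_ne_zero]
  simpa [unitSphereMeasure] using (hausdorffMeasure_sphere_pos m).ne'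

lemma isRotationInvariantOnSphere_unitSphereMeasure :
    IsRotationInvariantOnSphere (unitSphereMeasure m) where
  ae_norm_eq_one := by
    rw [unitSphereMeasure, ae_restrict_iff' Metric.isClosed_sphere.measurableSet]
    exact ae_of_all _ fun x hx => by simpa using hx
  map_eq e := by
    have h := e.toIsometryEquiv.map_hausdorffMeasure (m : ℝ)
    have hs : Metric.sphere (0 : EuclideanSpace ℝ (Fin (m + 1))) 1 =
        e ⁻¹' Metric.sphere 0 1 := by ext; simp
    conv_lhs => rw [unitSphereMeasure, hs]
    rw [← Measure.restrict_map e.continuous.measurable Metric.isClosed_sphere.measurableSet]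
    rw [unitSphereMeasure]
    congr 1

lemma hausdorffMeasure_restrict_sphere {r : ℝ} (hr : 0 < r) :
    (μH[(m : ℝ)]).restrict (Metric.sphere (0 : EuclideanSpace ℝ (Fin (m + 1))) r) =
      ENNReal.ofReal (r ^ m) • (unitSphereMeasure m).map (fun x => r • x) := by
  have hm : Measurable fun x : EuclideanSpace ℝ (Fin (m + 1)) => r • x := by fun_prop
  ext s hs
  rw [Measure.restrict_apply hs, Measure.smul_apply, Measure.map_apply hm hs, unitSphereMeasure,
    Measure.restrict_apply (hm hs)]
  have e : s ∩ Metric.sphere 0 r = r • ((fun x => r • x) ⁻¹' s ∩ Metric.sphere 0 1) := by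
    ext x
    rw [Set.mem_smul_set_iff_inv_smul_mem₀ hr.ne']
    simp only [Set.mem_inter_iff, mem_sphere_zero_iff_norm, Set.mem_preimage,
      smul_inv_smul₀ hr.ne', norm_smul, norm_inv, Real.norm_of_nonneg hr.le]
    rw [inv_mul_eq_one₀ hr.ne', eq_comm (a := r)]
  rw [e, Measure.hausdorffMeasure_smul₀ (Nat.cast_nonneg m) hr.ne', ENNReal.smul_def]
  congr 1
  rw [NNReal.rpow_natCast, ENNReal.coe_pow, ENNReal.ofReal_pow hr.le]
  congr 1
  exact Real.enorm_of_nonneg hr.le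

lemma integral_sphere_eq {r : ℝ} (hr : 0 < r) (f : EuclideanSpace ℝ (Fin (m + 1)) → ℝ) :
    ∫ x in Metric.sphere 0 r, f x ∂(μH[(m : ℝ)]) =
      r ^ m * ∫ x, f (r • x) ∂(unitSphereMeasure m) := by
  rw [hausdorffMeasure_restrict_sphere hr, integral_smul_measure,
    ENNReal.toReal_ofReal (by positivity), smul_eq_mul]
  congr 1
  exact (Homeomorph.smulOfNeZero r hr.ne').measurableEmbedding.integral_map f

lemma integrable_unitSphereMeasure {f : EuclideanSpace ℝ (Fin (m + 1)) → ℝ} (hf : Continuous f) :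
    Integrable f (unitSphereMeasure m) := by
  obtain ⟨C, hC⟩ := (isCompact_sphere (0 : EuclideanSpace ℝ (Fin (m + 1))) 1
    ).exists_bound_of_continuousOn hf.continuousOn
  refine Integrable.of_bound hf.aestronglyMeasurable C ?_
  filter_upwards [isRotationInvariantOnSphere_unitSphereMeasure.ae_norm_eq_one] with x hx
  exact hC x (by simpa using hx)

lemma integrableOn_sphere {r : ℝ} (hr : 0 < r) {f : EuclideanSpace ℝ (Fin (m + 1)) → ℝ}
    (hf : Continuous f) : IntegrableOn f (Metric.sphere 0 r) (μH[(m : ℝ)]) := by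
  rw [IntegrableOn, hausdorffMeasure_restrict_sphere hr]
  refine Integrable.smul_measure ?_ (by simp)
  exact (Homeomorph.smulOfNeZero r hr.ne').measurableEmbedding.integrable_map_iff.2
    (integrable_unitSphereMeasure (hf.comp (continuous_const_smul r)))

end UnitSphereMeasure

section SpherePoincare

open ProbabilityTheory

variable {E : Type*} [NormedAddCommGroup E] [InnerProductSpace ℝ E]

lemma hasFDerivAt_norm_of_ne_zero {x : E} (hx : x ≠ 0) :
    HasFDerivAt (fun y : E => ‖y‖) (‖x‖⁻¹ • innerSL ℝ x) x := by
  have h := ((hasStrictFDerivAt_norm_sq x).hasFDerivAt).sqrt (by simpa using hx)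
  simp only [Real.sqrt_sq (norm_nonneg _)] at h
  convert h using 1
  ext v
  simp
  ring

lemma hasFDerivAt_inv_norm_smul {x : E} (hx : x ≠ 0) :
    HasFDerivAt (fun y : E => ‖y‖⁻¹ • y)
      (‖x‖⁻¹ • ContinuousLinearMap.id ℝ E +
        (-(‖x‖ ^ 2)⁻¹ • ‖x‖⁻¹ • innerSL ℝ x).smulRight x) x :=
  ((hasDerivAt_inv (norm_ne_zero_iff.2 hx)).comp_hasFDerivAt x
    (hasFDerivAt_norm_of_ne_zero hx)).smul (hasFDerivAt_id x)

variable [FiniteDimensional ℝ E]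

/-- Gradient of the `1`-homogeneous extension of the restriction of a function to the sphere. -/
lemma hasGradientAt_norm_mul_comp_inv_norm_smul {g : E → ℝ} {x w : E} (hx : x ≠ 0)
    (hg : HasGradientAt g w (‖x‖⁻¹ • x)) :
    HasGradientAt (fun y => ‖y‖ * g (‖y‖⁻¹ • y))
      (g (‖x‖⁻¹ • x) • ‖x‖⁻¹ • x + (w - inner ℝ w (‖x‖⁻¹ • x) • ‖x‖⁻¹ • x)) x := by
  rw [hasGradientAt_iff_hasFDerivAt] at hg ⊢
  have h1 := HasFDerivAt.comp (f := fun y : E => ‖y‖⁻¹ • y) x hg (hasFDerivAt_inv_norm_smul hx)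
  have h2 := (hasFDerivAt_norm_of_ne_zero hx).mul h1
  refine h2.congr_fderiv ?_
  have hx' : ‖x‖ ≠ 0 := norm_ne_zero_iff.2 hx
  ext v
  simp [inner_smul_right]
  field_simp
  ring

omit [FiniteDimensional ℝ E] in
lemma norm_sq_radial_add_tangential {u w : E} (t : ℝ) (hu : ‖u‖ = 1) :
    ‖t • u + (w - inner ℝ w u • u)‖ ^ 2 = t ^ 2 + (‖w‖ ^ 2 - inner ℝ w u ^ 2) := by
  rw [← real_inner_self_eq_norm_sq]
  simp only [inner_add_left, inner_sub_left, inner_smul_left, inner_add_right, inner_smul_right,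
    inner_sub_right, real_inner_self_eq_norm_sq, hu, real_inner_comm u w]
  simp
  ring

lemma ContDiff.continuous_gradient {f : E → ℝ} {k : WithTop ℕ∞} (hf : ContDiff ℝ k f)
    (hk : k ≠ 0) : Continuous (gradient f) :=
  (InnerProductSpace.toDual ℝ E).symm.continuous.comp (hf.continuous_fderiv hk)

lemma ContDiff.hasGradientAt {f : E → ℝ} {k : WithTop ℕ∞} (hf : ContDiff ℝ k f)
    (hk : k ≠ 0) (x : E) : HasGradientAt f (gradient f x) x :=
  (hf.differentiable hk x).hasGradientAt

variable [MeasurableSpace E] [BorelSpace E]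

lemma stdGaussian_singleton_zero [Nontrivial E] : stdGaussian E {0} = 0 := by
  obtain ⟨v, hv⟩ := exists_ne (0 : E)
  have h := IsGaussian.map_eq_gaussianReal (μ := stdGaussian E) (innerSL ℝ v)
  have hne : (Var[innerSL ℝ v; stdGaussian E]).toNNReal ≠ 0 := by
    rw [variance_dual_stdGaussian]
    simpa using hv
  have hna := nullSingletonClass_gaussianReal
    (μ := ∫ x, (innerSL ℝ v) x ∂(stdGaussian E)) hne
  rw [← h] at hna
  have h0 : (stdGaussian E).map (innerSL ℝ v) {0} = 0 := measure_singleton 0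
  rw [Measure.map_apply (by fun_prop) (measurableSet_singleton 0)] at h0
  exact measure_mono_null (by rintro x rfl; simp) h0

lemma integral_norm_sq_stdGaussian :
    ∫ x, ‖x‖ ^ 2 ∂(stdGaussian E) = Module.finrank ℝ E := by
  set b := stdOrthonormalBasis ℝ E
  simp only [← b.sum_sq_inner_right]
  rw [integral_finsetSum]
  · simp [integral_inner_sq_stdGaussian]
  · intro i _
    refine (integrable_norm_pow_stdGaussian (E := E) 2).mono' (by fun_prop)
      (ae_of_all _ fun x => ?_)
    rw [Real.norm_of_nonneg (sq_nonneg _), ← sq_abs]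
    have := abs_real_inner_le_norm (b i) x
    rw [b.norm_eq_one, one_mul] at this
    exact pow_le_pow_left₀ (abs_nonneg _) this 2

/-- Integration against a Gaussian of a function that is homogeneous of degree `k`. -/
lemma IsRotationInvariantOnSphere.exists_integral_stdGaussian_eq [Nontrivial E] {μ : Measure E}
    [IsFiniteMeasure μ] (hμ : IsRotationInvariantOnSphere μ) (hμ0 : μ ≠ 0) (k : ℕ) :
    ∃ c : ℝ, c * μ.real Set.univ = ∫ x, ‖x‖ ^ k ∂(stdGaussian E) ∧
      ∀ g : E → ℝ, Measurable g →
        ∫ x, ‖x‖ ^ k * g (‖x‖⁻¹ • x) ∂(stdGaussian E) = c * ∫ x, g x ∂μ := by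
  set γ := stdGaussian E with hγ
  set ρ : E → ENNReal := fun x => ENNReal.ofReal (‖x‖ ^ k) with hρ
  have hρm : Measurable ρ := by fun_prop
  set P : E → E := fun x => ‖x‖⁻¹ • x with hP
  have hPm : Measurable P := by fun_prop
  have hfin : IsFiniteMeasure (γ.withDensity ρ) :=
    isFiniteMeasure_withDensity_ofReal (integrable_norm_pow_stdGaussian k).2
  set ν := (γ.withDensity ρ).map P with hν
  have hνi : IsRotationInvariantOnSphere ν := by
    refine ⟨?_, fun e => ?_⟩
    · rw [hν, ae_map_iff hPm.aemeasurable (measurableSet_eq_fun (by fun_prop) (by fun_prop))]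
      refine (withDensity_absolutelyContinuous γ ρ).ae_le ?_
      have h0 : ∀ᵐ x ∂γ, x ≠ 0 := by
        rw [ae_iff]; simpa using stdGaussian_singleton_zero (E := E)
      filter_upwards [h0] with x hx
      simp [hP, norm_smul, hx]
    · have hem : Measurable e := e.continuous.measurable
      have h1 : (γ.withDensity ρ).map e = γ.withDensity ρ := by
        ext s hs
        rw [Measure.map_apply hem hs, withDensity_apply _ (hem hs), withDensity_apply _ hs]
        conv_rhs => rw [hγ, ← stdGaussian_map e]
        rw [setLIntegral_map hs hρm hem]
        simp [hρ, hγ]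
      have h2 : (e : E → E) ∘ P = P ∘ e := by
        ext x; simp [hP]
      conv_rhs => rw [hν, ← h1]
      rw [hν, Measure.map_map hem hPm, Measure.map_map hPm hem, h2]
  have key := hμ.eq_smul hνi hμ0
  set c := ν Set.univ / μ Set.univ with hc
  have hintg : ∀ g : E → ℝ, Measurable g →
      ∫ x, ‖x‖ ^ k * g (‖x‖⁻¹ • x) ∂γ = c.toReal * ∫ x, g x ∂μ := by
    intro g hg
    rw [← smul_eq_mul, ← integral_smul_measure, ← key, hν,
      integral_map hPm.aemeasurable hg.aestronglyMeasurable,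
      integral_withDensity_eq_integral_toReal_smul hρm (by simp [hρ])]
    refine integral_congr_ae (ae_of_all _ fun x => ?_)
    simp [hρ, hP]
  refine ⟨c.toReal, ?_, hintg⟩
  have := hintg (fun _ => 1) measurable_const
  simp only [mul_one, integral_const, smul_eq_mul] at this
  exact this.symm

/-- The Poincaré inequality on the unit sphere. -/
lemma IsRotationInvariantOnSphere.poincare [Nontrivial E] {μ : Measure E}
    [IsFiniteMeasure μ] (hμ : IsRotationInvariantOnSphere μ) (hμ0 : μ ≠ 0) {F : E → ℝ}
    (hF : ContDiff ℝ 1 F) :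
    ((Module.finrank ℝ E : ℝ) - 1) *
        (∫ x, F x ^ 2 ∂μ - (∫ x, F x ∂μ) ^ 2 / μ.real Set.univ) ≤
      ∫ x, (‖gradient F x‖ ^ 2 - (inner ℝ (gradient F x) x) ^ 2) ∂μ := by
  have hintg : ∀ f : E → ℝ, Continuous f → Integrable f μ := by
    intro f hf
    obtain ⟨C, hC⟩ := (isCompact_sphere (0 : E) 1).exists_bound_of_continuousOn hf.continuousOn
    refine Integrable.of_bound hf.aestronglyMeasurable C ?_
    filter_upwards [hμ.ae_norm_eq_one] with x hx
    exact hC x (by simpa using hx)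
  set a := μ.real Set.univ with ha
  have ha0 : 0 < a := by
    rw [ha, measureReal_def, ENNReal.toReal_pos_iff]
    exact ⟨by simpa [pos_iff_ne_zero] using hμ0, measure_lt_top _ _⟩
  have hFc : Continuous F := hF.continuous
  have hgc : Continuous (gradient F) := hF.continuous_gradient one_ne_zero
  set avg := (∫ x, F x ∂μ) / a with havg
  set g : E → ℝ := fun x => F x - avg with hg
  have hgcont : Continuous g := by fun_prop
  have hgmean : ∫ x, g x ∂μ = 0 := by
    rw [integral_sub (hintg F hFc) (integrable_const _), integral_const, smul_eq_mul, havg, ← ha]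
    field_simp
    ring
  have hgsq : ∫ x, g x ^ 2 ∂μ = ∫ x, F x ^ 2 ∂μ - (∫ x, F x ∂μ) ^ 2 / a := by
    have e : ∀ x, g x ^ 2 = F x ^ 2 - 2 * avg * F x + avg ^ 2 := fun x => by
      simp only [hg]; ring
    simp only [e]
    rw [integral_add (hintg _ (by fun_prop)) (integrable_const _),
      integral_sub (hintg _ (by fun_prop)) (hintg _ (by fun_prop)), integral_const_mul,
      integral_const, smul_eq_mul, ← ha, havg]
    field_simp
    ring
  set h : E → ℝ := fun x => ‖x‖ * g (‖x‖⁻¹ • x) with hh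
  set G : E → E := fun x => g (‖x‖⁻¹ • x) • ‖x‖⁻¹ • x +
    (gradient F (‖x‖⁻¹ • x) - inner ℝ (gradient F (‖x‖⁻¹ • x)) (‖x‖⁻¹ • x) • ‖x‖⁻¹ • x) with hG
  have hPball : ∀ x : E, ‖x‖⁻¹ • x ∈ Metric.closedBall (0 : E) 1 := fun x => by
    rw [mem_closedBall_zero_iff, norm_smul, norm_inv, norm_norm]
    exact inv_mul_le_one
  set Gs : E → E := fun u => g u • u + (gradient F u - inner ℝ (gradient F u) u • u) with hGs
  have hGsc : Continuous Gs := by fun_prop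
  have hGGs : ∀ x, G x = Gs (‖x‖⁻¹ • x) := fun x => rfl
  obtain ⟨C1, hC1⟩ := (isCompact_closedBall (0 : E) 1).exists_bound_of_continuousOn
    hGsc.continuousOn
  obtain ⟨C2, hC2⟩ := (isCompact_closedBall (0 : E) 1).exists_bound_of_continuousOn
    hgcont.continuousOn
  have hPm : Measurable fun x : E => ‖x‖⁻¹ • x := by fun_prop
  have hle : ∀ x, |h x| ≤ C2 * ‖x‖ := fun x => by
    rw [hh, abs_mul, abs_norm, mul_comm]
    exact mul_le_mul_of_nonneg_right (hC2 _ (hPball x)) (norm_nonneg _)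
  have hhc : Continuous h := by
    rw [continuous_iff_continuousAt]
    intro x
    rcases eq_or_ne x 0 with rfl | hx
    · have h0 : h 0 = 0 := by simp [hh]
      rw [ContinuousAt, h0]
      refine squeeze_zero_norm hle ?_
      have : Continuous fun x : E => C2 * ‖x‖ := by fun_prop
      simpa using this.tendsto 0
    · have hx' : ‖x‖ ≠ 0 := norm_ne_zero_iff.2 hx
      have h1 : ContinuousAt (fun y : E => ‖y‖⁻¹ • y) x :=
        (continuous_norm.continuousAt.inv₀ hx').smul continuousAt_id
      exact continuous_norm.continuousAt.mul
        (ContinuousAt.comp (g := g) (f := fun y : E => ‖y‖⁻¹ • y) hgcont.continuousAt h1)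
  have hGm : Measurable G := hGsc.measurable.comp hPm
  have hgrad : ∀ x ≠ 0, HasGradientAt h (G x) x := fun x hx =>
    hasGradientAt_norm_mul_comp_inv_norm_smul hx
      (by
        have := hF.hasGradientAt one_ne_zero (‖x‖⁻¹ • x)
        rw [hasGradientAt_iff_hasFDerivAt] at this ⊢
        exact this.sub_const avg)
  obtain ⟨c0, hc0, hi0⟩ := hμ.exists_integral_stdGaussian_eq hμ0 0
  obtain ⟨c1, -, hi1⟩ := hμ.exists_integral_stdGaussian_eq hμ0 1
  obtain ⟨c2, hc2, hi2⟩ := hμ.exists_integral_stdGaussian_eq hμ0 2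
  have hmean : ∫ x, h x ∂(stdGaussian E) = 0 := by
    have := hi1 g hgcont.measurable
    rw [hgmean, mul_zero] at this
    simpa [hh] using this
  have hP := integral_sq_le_integral_norm_gradient_sq_stdGaussian (C := max C1 C2) hhc hGm
    (fun x => (hC1 _ (hPball x)).trans (le_max_left _ _))
    (fun x => (hle x).trans (by gcongr; exact le_max_right _ _)) hgrad hmean
  have e1 : ∫ x, h x ^ 2 ∂(stdGaussian E) = c2 * ∫ x, g x ^ 2 ∂μ := by
    rw [← hi2 _ (by fun_prop)]
    simp [hh, mul_pow]
  have e2 : ∫ x, ‖G x‖ ^ 2 ∂(stdGaussian E) = c0 * ∫ x, ‖Gs x‖ ^ 2 ∂μ := by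
    rw [← hi0 _ (by fun_prop)]
    simp [hGGs]
  have e3 : ∫ x, ‖Gs x‖ ^ 2 ∂μ = ∫ x, g x ^ 2 ∂μ +
      ∫ x, (‖gradient F x‖ ^ 2 - (inner ℝ (gradient F x) x) ^ 2) ∂μ := by
    rw [← integral_add (hintg _ (by fun_prop)) (hintg _ (by fun_prop))]
    refine integral_congr_ae ?_
    filter_upwards [hμ.ae_norm_eq_one] with x hx
    exact norm_sq_radial_add_tangential _ hx
  rw [e1, e2, e3] at hP
  rw [integral_norm_sq_stdGaussian, ← ha] at hc2
  simp only [pow_zero, integral_const, smul_eq_mul, mul_one, probReal_univ, ← ha] at hc0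
  rw [← hgsq]
  have h1 : c0 = 1 / a := by field_simp; linarith
  have h2 : c2 = Module.finrank ℝ E / a := by field_simp; linarith
  rw [h1, h2, div_mul_eq_mul_div, div_mul_eq_mul_div, div_le_div_iff_of_pos_right ha0] at hP
  linarith

end SpherePoincare

section PolarCoordinates

open scoped Pointwise

lemma isRotationInvariantOnSphere_map_toSphere {E : Type*} [NormedAddCommGroup E]
    [InnerProductSpace ℝ E] [FiniteDimensional ℝ E] [MeasurableSpace E] [BorelSpace E] :
    IsRotationInvariantOnSphere
      ((volume : Measure E).toSphere.map (Subtype.val : Metric.sphere (0 : E) 1 → E)) where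
  ae_norm_eq_one := by
    rw [ae_map_iff (by fun_prop) (measurableSet_eq_fun (by fun_prop) (by fun_prop))]
    exact ae_of_all _ fun x => by simp
  map_eq e := by
    have hem : Measurable e := e.continuous.measurable
    ext s hs
    rw [Measure.map_apply hem hs, Measure.map_apply measurable_subtype_coe (hem hs),
      Measure.map_apply measurable_subtype_coe hs,
      Measure.toSphere_apply' _ (measurable_subtype_coe (hem hs)),
      Measure.toSphere_apply' _ (measurable_subtype_coe hs)]
    congr 1
    rw [Subtype.image_preimage_coe, Subtype.image_preimage_coe]
    have : Set.Ioo (0 : ℝ) 1 • (Metric.sphere (0 : E) 1 ∩ e ⁻¹' s) =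
        e ⁻¹' (Set.Ioo (0 : ℝ) 1 • (Metric.sphere (0 : E) 1 ∩ s)) := by
      ext x
      simp only [Set.mem_smul, Set.mem_preimage, Set.mem_inter_iff, mem_sphere_zero_iff_norm]
      constructor
      · rintro ⟨t, ht, y, hy, rfl⟩
        exact ⟨t, ht, e y, ⟨by simpa using hy.1, hy.2⟩, by simp⟩
      · rintro ⟨t, ht, y, hy, hxy⟩
        refine ⟨t, ht, e.symm y, ⟨by simpa using hy.1, by simpa using hy.2⟩, ?_⟩
        rw [← map_smul, hxy, e.symm_apply_apply]
    rw [this]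
    exact e.measurePreserving.measure_preimage_emb e.toHomeomorph.measurableEmbedding _

variable {m : ℕ}

lemma unitSphereMeasure_real_univ_pos : 0 < (unitSphereMeasure m).real Set.univ := by
  rw [measureReal_def, ENNReal.toReal_pos_iff]
  exact ⟨by simpa [pos_iff_ne_zero] using unitSphereMeasure_ne_zero, measure_lt_top _ _⟩

/-- The ratio between Mathlib's polar surface measure and the Hausdorff measure on the sphere. -/
noncomputable def polarConst (m : ℕ) : ℝ :=
  ((m + 1) * volume.real (Metric.ball (0 : EuclideanSpace ℝ (Fin (m + 1))) 1)) /
    (unitSphereMeasure m).real Set.univ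

lemma polarConst_pos : 0 < polarConst m := by
  refine div_pos (mul_pos (by positivity) ?_) unitSphereMeasure_real_univ_pos
  exact ENNReal.toReal_pos (Metric.measure_ball_pos _ _ one_pos).ne' measure_ball_lt_top.ne

lemma integral_toSphere_eq (g : EuclideanSpace ℝ (Fin (m + 1)) → ℝ) :
    ∫ x : Metric.sphere (0 : EuclideanSpace ℝ (Fin (m + 1))) 1, g x
      ∂(volume : Measure (EuclideanSpace ℝ (Fin (m + 1)))).toSphere =
      polarConst m * ∫ x, g x ∂(unitSphereMeasure m) := by
  have h := isRotationInvariantOnSphere_unitSphereMeasure.eq_smul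
    (isRotationInvariantOnSphere_map_toSphere (E := EuclideanSpace ℝ (Fin (m + 1))))
    unitSphereMeasure_ne_zero
  rw [← (MeasurableEmbedding.subtype_coe Metric.isClosed_sphere.measurableSet).integral_map, h,
    integral_smul_measure, smul_eq_mul, ENNReal.toReal_div,
    Measure.map_apply measurable_subtype_coe .univ, Set.preimage_univ,
    Measure.toSphere_apply_univ]
  congr 1
  have e : ((m : ENNReal) + 1).toReal = (m : ℝ) + 1 := by
    rw [ENNReal.toReal_add (by simp) (by simp)]; simp
  simp [polarConst, measureReal_def, e]

/-- Integration in polar coordinates. -/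
lemma integral_eq_polar {G : EuclideanSpace ℝ (Fin (m + 1)) → ℝ} (hG : Integrable G) :
    ∫ x, G x = polarConst m *
      ∫ r in Set.Ioi (0 : ℝ), r ^ m * ∫ x, G (r • x) ∂(unitSphereMeasure m) := by
  have hdim : Module.finrank ℝ (EuclideanSpace ℝ (Fin (m + 1))) - 1 = m := by simp
  have hmp := Measure.measurePreserving_homeomorphUnitSphereProd
    (volume : Measure (EuclideanSpace ℝ (Fin (m + 1))))
  rw [hdim] at hmp
  have hemb := (homeomorphUnitSphereProd (EuclideanSpace ℝ (Fin (m + 1)))).measurableEmbedding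
  set H : Metric.sphere (0 : EuclideanSpace ℝ (Fin (m + 1))) 1 × Set.Ioi (0 : ℝ) → ℝ :=
    fun p => G (p.2.1 • p.1.1) with hH
  have hHG : ∀ x : ({0}ᶜ : Set (EuclideanSpace ℝ (Fin (m + 1)))),
      H (homeomorphUnitSphereProd (EuclideanSpace ℝ (Fin (m + 1))) x) = G x := by
    intro x
    have : ‖x.1‖ ≠ 0 := norm_ne_zero_iff.2 x.2
    simp [hH, smul_smul, this]
  have hHint : Integrable H (volume.toSphere.prod (Measure.volumeIoiPow m)) := by
    rw [← hmp.integrable_comp_emb hemb]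
    have : H ∘ (homeomorphUnitSphereProd (EuclideanSpace ℝ (Fin (m + 1)))) =
        fun x : ({0}ᶜ : Set (EuclideanSpace ℝ (Fin (m + 1)))) => G x := funext hHG
    rw [this]
    exact (integrableOn_iff_comap_subtypeVal (measurableSet_singleton _).compl).1 hG.integrableOn
  calc ∫ x, G x
    _ = ∫ x : ({0}ᶜ : Set (EuclideanSpace ℝ (Fin (m + 1)))), G x ∂(volume.comap Subtype.val) := by
        rw [integral_subtype_comap (measurableSet_singleton _).compl fun x => G x,
          restrict_compl_singleton]
    _ = ∫ p, H p ∂(volume.toSphere.prod (Measure.volumeIoiPow m)) := by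
        rw [← hmp.integral_comp hemb]
        simp only [hHG]
    _ = ∫ r : Set.Ioi (0 : ℝ), polarConst m * ∫ x, G (r.1 • x) ∂(unitSphereMeasure m)
          ∂(Measure.volumeIoiPow m) := by
        rw [integral_prod_symm _ hHint]
        refine integral_congr_ae (ae_of_all _ fun r => ?_)
        exact integral_toSphere_eq fun x => G (r.1 • x)
    _ = _ := by
        rw [integral_const_mul]
        congr 1
        simp only [Measure.volumeIoiPow, ENNReal.ofReal]
        rw [integral_withDensity_eq_integral_smul,
          integral_subtype_comap measurableSet_Ioi fun a : ℝ =>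
            Real.toNNReal (a ^ m) • ∫ x, G (a • x) ∂(unitSphereMeasure m)]
        · refine setIntegral_congr_fun measurableSet_Ioi fun x hx => ?_
          simp only [NNReal.smul_def, Real.coe_toNNReal _ (pow_nonneg (le_of_lt hx) m),
            smul_eq_mul]
        · exact (measurable_subtype_coe.pow_const _).real_toNNReal

lemma setIntegral_annulus_eq {G : EuclideanSpace ℝ (Fin (m + 1)) → ℝ} (hG : Continuous G)
    {ε : ℝ} (h0 : 0 ≤ ε) (h1 : ε ≤ 1) :
    ∫ x in {x | ε < ‖x‖ ∧ ‖x‖ < 1}, G x = polarConst m *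
      ∫ r in ε..1, r ^ m * ∫ x, G (r • x) ∂(unitSphereMeasure m) := by
  set A : Set (EuclideanSpace ℝ (Fin (m + 1))) := {x | ε < ‖x‖ ∧ ‖x‖ < 1} with hA
  have hAm : MeasurableSet A :=
    (measurableSet_lt measurable_const measurable_norm).inter
      (measurableSet_lt measurable_norm measurable_const)
  have hintg : IntegrableOn G A :=
    (hG.continuousOn.integrableOn_compact (isCompact_closedBall 0 1)).mono_set
      fun x hx => by simpa using hx.2.le
  rw [← integral_indicator hAm, integral_eq_polar ((integrable_indicator_iff hAm).2 hintg)]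
  congr 1
  rw [intervalIntegral.integral_of_le h1, integral_Ioc_eq_integral_Ioo,
    ← integral_indicator measurableSet_Ioi, ← integral_indicator measurableSet_Ioo]
  congr 1
  ext r
  by_cases hr : 0 < r
  · have hA' : ∀ᵐ x ∂(unitSphereMeasure m), (r • x ∈ A ↔ r ∈ Set.Ioo ε 1) := by
      filter_upwards [isRotationInvariantOnSphere_unitSphereMeasure.ae_norm_eq_one] with x hx
      simp [hA, norm_smul, hx, abs_of_pos hr]
    rw [Set.indicator_of_mem (show r ∈ Set.Ioi 0 from hr)]
    by_cases hr2 : r ∈ Set.Ioo ε 1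
    · rw [Set.indicator_of_mem hr2]
      congr 1
      refine integral_congr_ae ?_
      filter_upwards [hA'] with x hx
      exact Set.indicator_of_mem (hx.2 hr2) _
    · rw [Set.indicator_of_notMem hr2, integral_eq_zero_of_ae, mul_zero]
      filter_upwards [hA'] with x hx
      exact Set.indicator_of_notMem (fun h => hr2 (hx.1 h)) _
  · rw [Set.indicator_of_notMem (show r ∉ Set.Ioi 0 from hr),
      Set.indicator_of_notMem (fun h => hr (h0.trans_lt h.1))]

end PolarCoordinates

section SphericalMeans

variable {m : ℕ}

/-- The integral of `x ↦ f (r • x)` over the unit sphere. -/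
noncomputable def sphereMean (f : EuclideanSpace ℝ (Fin (m + 1)) → ℝ) (r : ℝ) : ℝ :=
  ∫ x, f (r • x) ∂(unitSphereMeasure m)

lemma unitSphereMeasure_restrict_sphere :
    (unitSphereMeasure m).restrict (Metric.sphere 0 1) = unitSphereMeasure m := by
  rw [unitSphereMeasure, Measure.restrict_restrict Metric.isClosed_sphere.measurableSet,
    Set.inter_self]

lemma continuous_integral_unitSphereMeasure {Φ : ℝ → EuclideanSpace ℝ (Fin (m + 1)) → ℝ}
    (hΦ : Continuous Φ.uncurry) : Continuous fun r => ∫ x, Φ r x ∂(unitSphereMeasure m) := by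
  have := continuous_parametric_integral_of_continuous (μ := unitSphereMeasure m) hΦ
    (isCompact_sphere 0 1)
  rwa [unitSphereMeasure_restrict_sphere] at this

lemma continuous_sphereMean {f : EuclideanSpace ℝ (Fin (m + 1)) → ℝ} (hf : Continuous f) :
    Continuous (sphereMean f) :=
  continuous_integral_unitSphereMeasure (Φ := fun r x => f (r • x)) (by
    simp only [Function.uncurry_def]; fun_prop)

lemma hasDerivAt_comp_smul {E : Type*} [NormedAddCommGroup E] [InnerProductSpace ℝ E]
    [FiniteDimensional ℝ E] {f : E → ℝ} (hf : ContDiff ℝ 1 f) (x : E) (r : ℝ) :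
    HasDerivAt (fun r : ℝ => f (r • x)) (inner ℝ (gradient f (r • x)) x) r := by
  have h1 : HasDerivAt (fun r : ℝ => r • x) x r := by
    simpa using (hasDerivAt_id r).smul_const x
  exact ((hf.hasGradientAt one_ne_zero (r • x)).hasFDerivAt.comp_hasDerivAt r h1).congr_deriv
    (by simp)

lemma hasDerivAt_sphereMean {f : EuclideanSpace ℝ (Fin (m + 1)) → ℝ} (hf : ContDiff ℝ 1 f)
    (r : ℝ) : HasDerivAt (sphereMean f)
      (∫ x, inner ℝ (gradient f (r • x)) x ∂(unitSphereMeasure m)) r := by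
  have hg := hf.continuous_gradient one_ne_zero
  have hcont : Continuous fun p : ℝ × EuclideanSpace ℝ (Fin (m + 1)) =>
      inner ℝ (gradient f (p.1 • p.2)) p.2 := by fun_prop
  obtain ⟨C, hC⟩ := ((isCompact_closedBall r 1).prod
    (isCompact_sphere (0 : EuclideanSpace ℝ (Fin (m + 1))) 1)).exists_bound_of_continuousOn
    hcont.continuousOn
  refine (hasDerivAt_integral_of_dominated_loc_of_deriv_le (μ := unitSphereMeasure m)
    (F := fun t x => f (t • x)) (F' := fun t x => inner ℝ (gradient f (t • x)) x)
    (bound := fun _ => C) (Metric.ball_mem_nhds r one_pos) ?_ ?_ ?_ ?_ (integrable_const C) ?_).2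
  · exact Filter.Eventually.of_forall fun t =>
      (hf.continuous.comp (continuous_const_smul t)).aestronglyMeasurable
  · exact integrable_unitSphereMeasure (hf.continuous.comp (continuous_const_smul r))
  · exact (hcont.comp (Continuous.prodMk_right r)).aestronglyMeasurable
  · filter_upwards [isRotationInvariantOnSphere_unitSphereMeasure.ae_norm_eq_one] with x hx t ht
    exact hC (t, x) ⟨Metric.ball_subset_closedBall ht, by simpa using hx⟩
  · exact ae_of_all _ fun x t _ => hasDerivAt_comp_smul hf x t

lemma gradient_comp_smul {E : Type*} [NormedAddCommGroup E] [InnerProductSpace ℝ E]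
    [FiniteDimensional ℝ E] {f : E → ℝ} (hf : ContDiff ℝ 1 f) (x : E) (r : ℝ) :
    gradient (fun y => f (r • y)) x = r • gradient f (r • x) := by
  refine HasGradientAt.gradient ?_
  have h := hf.hasGradientAt one_ne_zero (r • x)
  rw [hasGradientAt_iff_hasFDerivAt] at h ⊢
  have h1 : HasFDerivAt (fun y : E => r • y) (r • ContinuousLinearMap.id ℝ E) x :=
    (hasFDerivAt_id x).const_smul r
  refine (HasFDerivAt.comp (f := fun y : E => r • y) x h h1).congr_fderiv ?_
  ext v
  simp

lemma gradient_sq {E : Type*} [NormedAddCommGroup E] [InnerProductSpace ℝ E]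
    [FiniteDimensional ℝ E] {f : E → ℝ} (hf : ContDiff ℝ 1 f) (x : E) :
    gradient (fun y => f y ^ 2) x = (2 * f x) • gradient f x := by
  refine HasGradientAt.gradient ?_
  have h := hf.hasGradientAt one_ne_zero x
  rw [hasGradientAt_iff_hasFDerivAt] at h ⊢
  refine (h.pow 2).congr_fderiv ?_
  ext v
  simp

lemma hasDerivAt_sphereMean_sq {f : EuclideanSpace ℝ (Fin (m + 1)) → ℝ} (hf : ContDiff ℝ 1 f)
    (r : ℝ) : HasDerivAt (sphereMean fun x => f x ^ 2)
      (∫ x, 2 * f (r • x) * inner ℝ (gradient f (r • x)) x ∂(unitSphereMeasure m)) r := by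
  refine (hasDerivAt_sphereMean (hf.pow 2) r).congr_deriv ?_
  simp only [gradient_sq hf, inner_smul_left, conj_trivial]

/-- The spherical variance of `f` on the sphere of radius `r`. -/
noncomputable def sphereVar (f : EuclideanSpace ℝ (Fin (m + 1)) → ℝ) (r : ℝ) : ℝ :=
  sphereMean (fun x => f x ^ 2) r - sphereMean f r ^ 2 / (unitSphereMeasure m).real Set.univ

/-- Completing the square on a fixed sphere, combined with the Poincaré inequality there. -/
lemma radial_gradient_bound {f : EuclideanSpace ℝ (Fin (m + 1)) → ℝ}
    (hf : ContDiff ℝ 1 f) {r : ℝ} (hr : 0 < r) (φ : ℝ) :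
    (∫ x, inner ℝ (gradient f (r • x)) x ∂(unitSphereMeasure m)) ^ 2 /
        (unitSphereMeasure m).real Set.univ +
      φ * ((∫ x, 2 * f (r • x) * inner ℝ (gradient f (r • x)) x ∂(unitSphereMeasure m)) -
        2 * sphereMean f r * (∫ x, inner ℝ (gradient f (r • x)) x ∂(unitSphereMeasure m)) /
        (unitSphereMeasure m).real Set.univ) - φ ^ 2 * sphereVar f r +
      m * sphereVar f r / r ^ 2 ≤ sphereMean (fun x => ‖gradient f x‖ ^ 2) r := by
  have hg := hf.continuous_gradient one_ne_zero
  have hfc := hf.continuous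
  set σ := unitSphereMeasure m with hσ
  set a := σ.real Set.univ with ha
  have ha0 : 0 < a := unitSphereMeasure_real_univ_pos
  have hintg : ∀ g : EuclideanSpace ℝ (Fin (m + 1)) → ℝ, Continuous g → Integrable g σ :=
    fun g hg => integrable_unitSphereMeasure hg
  have hpoin := isRotationInvariantOnSphere_unitSphereMeasure.poincare
    (unitSphereMeasure_ne_zero (m := m)) (F := fun x => f (r • x)) (by fun_prop)
  simp only [gradient_comp_smul hf, norm_smul, inner_smul_left, conj_trivial,
    finrank_euclideanSpace, Fintype.card_fin, Real.norm_of_nonneg hr.le, mul_pow, ← mul_sub,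
    integral_const_mul, ← hσ, ← ha] at hpoin
  rw [integral_sub (hintg _ (by fun_prop)) (hintg _ (by fun_prop))] at hpoin
  push_cast at hpoin
  rw [add_sub_cancel_right] at hpoin
  set M' := ∫ x, inner ℝ (gradient f (r • x)) x ∂σ with hM'
  set S' := ∫ x, 2 * f (r • x) * inner ℝ (gradient f (r • x)) x ∂σ with hS'
  set R := ∫ x, inner ℝ (gradient f (r • x)) x ^ 2 ∂σ with hR
  have hV : sphereVar f r = ∫ x, f (r • x) ^ 2 ∂σ - (∫ x, f (r • x) ∂σ) ^ 2 / a := rfl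
  have hD : sphereMean (fun x => ‖gradient f x‖ ^ 2) r = ∫ x, ‖gradient f (r • x)‖ ^ 2 ∂σ := rfl
  rw [← hV, ← hD] at hpoin
  set M := sphereMean f r with hM
  have hMdef : M = ∫ x, f (r • x) ∂σ := rfl
  have hsq : 0 ≤ ∫ x, (inner ℝ (gradient f (r • x)) x - φ * f (r • x) - (M' - φ * M) / a) ^ 2 ∂σ :=
    integral_nonneg fun x => sq_nonneg _
  set k := (M' - φ * M) / a with hk
  have e : ∀ x, (inner ℝ (gradient f (r • x)) x - φ * f (r • x) - k) ^ 2 =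
      inner ℝ (gradient f (r • x)) x ^ 2 - φ * (2 * f (r • x) * inner ℝ (gradient f (r • x)) x) +
        φ ^ 2 * f (r • x) ^ 2 - 2 * k * inner ℝ (gradient f (r • x)) x +
        2 * k * φ * f (r • x) + k ^ 2 := fun x => by ring
  simp only [e] at hsq
  rw [integral_add (hintg _ (by fun_prop)) (hintg _ (by fun_prop)),
    integral_add (hintg _ (by fun_prop)) (hintg _ (by fun_prop)),
    integral_sub (hintg _ (by fun_prop)) (hintg _ (by fun_prop)),
    integral_add (hintg _ (by fun_prop)) (hintg _ (by fun_prop)),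
    integral_sub (hintg _ (by fun_prop)) (hintg _ (by fun_prop))] at hsq
  simp only [integral_const_mul, integral_const, smul_eq_mul, ← ha, ← hR, ← hS', ← hM',
    ← hMdef] at hsq
  rw [← hMdef] at hV
  have hS : ∫ x, f (r • x) ^ 2 ∂σ = sphereVar f r + M ^ 2 / a := by rw [hV]; ring
  rw [hS] at hsq
  have hR' : M' ^ 2 / a + φ * (S' - 2 * M * M' / a) - φ ^ 2 * sphereVar f r ≤ R := by
    have hka : k * a = M' - φ * M := by rw [hk]; field_simp
    have : R - φ * S' + φ ^ 2 * (sphereVar f r + M ^ 2 / a) - 2 * k * M' + 2 * k * φ * M + a * k ^ 2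
        = R - (M' ^ 2 / a + φ * (S' - 2 * M * M' / a) - φ ^ 2 * sphereVar f r) := by
      rw [hk]; field_simp; ring
    linarith
  have hP : m * sphereVar f r / r ^ 2 ≤ sphereMean (fun x => ‖gradient f x‖ ^ 2) r - R := by
    rw [div_le_iff₀ (by positivity)]
    linarith
  linarith

lemma sphereVar_nonneg {f : EuclideanSpace ℝ (Fin (m + 1)) → ℝ} (hf : Continuous f) (r : ℝ) :
    0 ≤ sphereVar f r := by
  set σ := unitSphereMeasure m with hσ
  set a := σ.real Set.univ with ha
  have ha0 : 0 < a := unitSphereMeasure_real_univ_pos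
  have hintg : ∀ g : EuclideanSpace ℝ (Fin (m + 1)) → ℝ, Continuous g → Integrable g σ :=
    fun g hg => integrable_unitSphereMeasure hg
  have hsq : 0 ≤ ∫ x, (f (r • x) - sphereMean f r / a) ^ 2 ∂σ :=
    integral_nonneg fun x => sq_nonneg _
  have hM : ∫ x, f (r • x) ∂σ = sphereMean f r := rfl
  have hS : ∫ x, f (r • x) ^ 2 ∂σ = sphereMean (fun x => f x ^ 2) r := rfl
  have e : ∀ x, (f (r • x) - sphereMean f r / a) ^ 2 =
      f (r • x) ^ 2 - 2 * (sphereMean f r / a) * f (r • x) + (sphereMean f r / a) ^ 2 :=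
    fun x => by ring
  simp only [e] at hsq
  rw [integral_add (hintg _ (by fun_prop)) (hintg _ (by fun_prop)),
    integral_sub (hintg _ (by fun_prop)) (hintg _ (by fun_prop))] at hsq
  simp only [integral_const_mul, integral_const, smul_eq_mul, ← ha, hM, hS] at hsq
  rw [sphereVar, ← hσ, ← ha]
  have : sphereMean (fun x => f x ^ 2) r - 2 * (sphereMean f r / a) * sphereMean f r +
      a * (sphereMean f r / a) ^ 2 = sphereMean (fun x => f x ^ 2) r - sphereMean f r ^ 2 / a := by
    field_simp; ring
  linarith

end SphericalMeans

section AnnulusLowerBound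

variable {m : ℕ}

/-- The logarithmic derivative of the radial profile `r + b r⁻ᵐ`. -/
noncomputable def radialLogDeriv (m : ℕ) (b r : ℝ) : ℝ :=
  (r ^ (m + 1) - m * b) / (r * (r ^ (m + 1) + b))

lemma hasDerivAt_radialLogDeriv {b r : ℝ} (hb : 0 < b) (hr : 0 < r) :
    HasDerivAt (radialLogDeriv m b)
      (m / r ^ 2 - m * radialLogDeriv m b r / r - radialLogDeriv m b r ^ 2) r := by
  have hd : 0 < r ^ (m + 1) + b := by positivity
  have h1 : HasDerivAt (fun r : ℝ => r ^ (m + 1) - m * b) ((m + 1) * r ^ m) r := by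
    simpa using (hasDerivAt_pow (m + 1) r).sub_const (m * b)
  have h2 : HasDerivAt (fun r : ℝ => r * (r ^ (m + 1) + b))
      (r ^ (m + 1) + b + r * ((m + 1) * r ^ m)) r := by
    simpa using (hasDerivAt_id' r).fun_mul ((hasDerivAt_pow (m + 1) r).add_const b)
  refine (h1.div h2 (by positivity)).congr_deriv ?_
  rw [radialLogDeriv]
  rw [pow_succ] at hd ⊢
  field_simp
  ring

lemma hasDerivAt_inv_pow_div {k : ℕ} (hk : k ≠ 0) {r : ℝ} (hr : 0 < r) :
    HasDerivAt (fun r : ℝ => (r ^ k)⁻¹ / k) (-(r ^ (k + 1))⁻¹) r := by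
  have h := ((hasDerivAt_pow k r).inv (by positivity)).div_const (k : ℝ)
  refine h.congr_deriv ?_
  obtain ⟨j, rfl⟩ := Nat.exists_eq_succ_of_ne_zero hk
  have : ((j.succ : ℕ) : ℝ) ≠ 0 := by positivity
  simp only [Nat.succ_eq_add_one, add_tsub_cancel_right] at this ⊢
  field_simp
  ring

lemma hasDerivAt_sphereVar {f : EuclideanSpace ℝ (Fin (m + 1)) → ℝ} (hf : ContDiff ℝ 1 f)
    (r : ℝ) : HasDerivAt (sphereVar f)
      ((∫ x, 2 * f (r • x) * inner ℝ (gradient f (r • x)) x ∂(unitSphereMeasure m)) -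
        2 * sphereMean f r * (∫ x, inner ℝ (gradient f (r • x)) x ∂(unitSphereMeasure m)) /
        (unitSphereMeasure m).real Set.univ) r := by
  refine ((hasDerivAt_sphereMean_sq hf r).sub
    (((hasDerivAt_sphereMean hf r).pow 2).div_const _)).congr_deriv ?_
  simp

/-- Lower bound for the radial energy obtained by integrating a total derivative. -/
lemma radial_energy_lower_bound (hm : 2 ≤ m) {f : EuclideanSpace ℝ (Fin (m + 1)) → ℝ}
    (hf : ContDiff ℝ 1 f) {ε b : ℝ} (hε : 0 < ε) (hε1 : ε ≤ 1) (hb : 0 < b) (c : ℝ) :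
    radialLogDeriv m b 1 * sphereVar f 1 - ε ^ m * radialLogDeriv m b ε * sphereVar f ε +
      (2 * c * (sphereMean f 1 - sphereMean f ε) +
        c ^ 2 * (1 - (ε ^ (m - 1))⁻¹) / ((m - 1 : ℕ) : ℝ)) / (unitSphereMeasure m).real Set.univ ≤
      ∫ r in ε..1, r ^ m * sphereMean (fun x => ‖gradient f x‖ ^ 2) r := by
  set a := (unitSphereMeasure m).real Set.univ with ha
  have ha0 : 0 < a := unitSphereMeasure_real_univ_pos
  have hm1 : m - 1 + 1 = m := by omega
  set W : ℝ → ℝ := fun r => r ^ m * radialLogDeriv m b r * sphereVar f r +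
    (2 * c * sphereMean f r + c ^ 2 * ((r ^ (m - 1))⁻¹ / ((m - 1 : ℕ) : ℝ))) / a with hW
  have hder : ∀ r : ℝ, 0 < r → HasDerivAt W _ r := fun r hr =>
    ((((hasDerivAt_pow m r).fun_mul (hasDerivAt_radialLogDeriv (m := m) hb hr)).mul
      (hasDerivAt_sphereVar hf r)).add
      ((((hasDerivAt_sphereMean hf r).const_mul (2 * c)).add
        ((hasDerivAt_inv_pow_div (k := m - 1) (by omega) hr).const_mul (c ^ 2))).div_const a))
  have hD : Continuous fun r : ℝ => r ^ m * sphereMean (fun x => ‖gradient f x‖ ^ 2) r := by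
    have hg := hf.continuous_gradient one_ne_zero
    exact (continuous_pow m).mul (continuous_sphereMean (by fun_prop))
  have key := intervalIntegral.sub_le_integral_of_hasDeriv_right_of_le (g := W) hε1
    (fun r hr => (hder r (hε.trans_le hr.1)).continuousAt.continuousWithinAt)
    (fun r hr => (hder r (hε.trans hr.1)).hasDerivWithinAt)
    (hD.integrableOn_Icc) (fun r hr => by
      have hr0 : 0 < r := hε.trans hr.1
      have hb := radial_gradient_bound hf hr0 (radialLogDeriv m b r)
      have hpos : (0 : ℝ) < r ^ m := by positivity
      refine le_trans ?_ (mul_le_mul_of_nonneg_left hb hpos.le)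
      rw [← ha] at hb ⊢
      rw [hm1]
      set φ := radialLogDeriv m b r
      set V := sphereVar f r
      set M' := ∫ x, inner ℝ (gradient f (r • x)) x ∂(unitSphereMeasure m)
      set S' := ∫ x, 2 * f (r • x) * inner ℝ (gradient f (r • x)) x ∂(unitSphereMeasure m)
      have hsq : 0 ≤ (r ^ m * M' - c) ^ 2 / (a * r ^ m) := by positivity
      have hp : r ^ m = r ^ (m - 1) * r := by rw [← pow_succ, hm1]
      rw [← sub_nonneg]
      refine hsq.trans_eq ?_
      rw [hp]
      have : (0 : ℝ) < r ^ (m - 1) := by positivity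
      field_simp
      ring)
  refine le_trans (le_of_eq ?_) key
  simp only [hW, one_pow, inv_one]
  have : ((m - 1 : ℕ) : ℝ) ≠ 0 := by
    rw [Nat.cast_ne_zero]; omega
  field_simp
  ring

lemma annulus_energy_lower_bound (hm : 2 ≤ m) {f : EuclideanSpace ℝ (Fin (m + 1)) → ℝ}
    (hf : ContDiff ℝ 1 f) {ε : ℝ} (hε : 0 < ε) (hε1 : ε ≤ 1 / 2)
    (hmean : sphereMean f 1 = -(ε ^ m * sphereMean f ε)) :
    (1 - m * ε ^ (m + 1)) / (1 + ε ^ (m + 1)) *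
      (ε ^ m * sphereMean (fun x => f x ^ 2) ε + sphereMean (fun x => f x ^ 2) 1) ≤
      ∫ r in ε..1, r ^ m * sphereMean (fun x => ‖gradient f x‖ ^ 2) r := by
  set y := sphereMean f ε with hy
  refine le_trans ?_ (radial_energy_lower_bound hm hf hε (by linarith)
    (b := ε ^ (m + 1)) (by positivity) (-(ε ^ (m - 1) * y)))
  set a := (unitSphereMeasure m).real Set.univ with ha
  have ha0 : 0 < a := unitSphereMeasure_real_univ_pos
  have h1 : radialLogDeriv m (ε ^ (m + 1)) 1 = (1 - m * ε ^ (m + 1)) / (1 + ε ^ (m + 1)) := by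
    simp [radialLogDeriv]
  have h2 : radialLogDeriv m (ε ^ (m + 1)) ε = -((m - 1) / (2 * ε)) := by
    rw [radialLogDeriv]
    field_simp
    ring
  rw [h1, h2, hmean]
  set lam := (1 - m * ε ^ (m + 1)) / (1 + ε ^ (m + 1)) with hlam
  have hlam1 : lam ≤ 1 := by
    rw [hlam, div_le_one (by positivity)]
    have : 0 ≤ m * ε ^ (m + 1) := by positivity
    have : 0 ≤ ε ^ (m + 1) := by positivity
    linarith
  have hS1 : sphereMean (fun x => f x ^ 2) 1 = sphereVar f 1 + (ε ^ m * y) ^ 2 / a := by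
    rw [sphereVar, hmean, ← ha]; ring
  have hSε : sphereMean (fun x => f x ^ 2) ε = sphereVar f ε + y ^ 2 / a := by
    rw [sphereVar, ← ha, ← hy]; ring
  rw [hS1, hSε]
  have hVε := sphereVar_nonneg hf.continuous ε
  have hmR : (2 : ℝ) ≤ m := by exact_mod_cast hm
  have hcast : ((m - 1 : ℕ) : ℝ) = (m : ℝ) - 1 := by
    rw [Nat.cast_sub (by omega), Nat.cast_one]
  rw [hcast]
  have hfac : 1 ≤ (m - 1) / (2 * ε) := by
    rw [le_div_iff₀ (by positivity)]; linarith
  have hp : ε ^ m = ε ^ (m - 1) * ε := by rw [← pow_succ]; congr 1; omega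
  set q := ε ^ (m - 1) with hq
  have hq0 : 0 < q := by positivity
  have hq1 : q ≤ 1 := pow_le_one₀ hε.le (by linarith)
  have hpm : 0 < ε ^ m := by positivity
  have hA : lam * (ε ^ m * sphereVar f ε) ≤ ε ^ m * ((m - 1) / (2 * ε)) * sphereVar f ε := by
    nlinarith [mul_nonneg hpm.le hVε, mul_nonneg (mul_nonneg hpm.le hVε)
      (sub_nonneg.2 hfac), mul_nonneg (mul_nonneg hpm.le hVε) (sub_nonneg.2 hlam1)]
  have hB : lam * ((ε ^ m) ^ 2 + ε ^ m) * y ^ 2 ≤ 2 * -(q * y) * (-(ε ^ m * y) - y) +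
      (-(q * y)) ^ 2 * (1 - q⁻¹) / (m - 1) := by
    have e1 : (-(q * y)) ^ 2 * (1 - q⁻¹) / ((m : ℝ) - 1) = -(q * y ^ 2 * ((1 - q) / (m - 1))) := by
      field_simp
      ring
    have e2 : (1 - q) / ((m : ℝ) - 1) ≤ 1 := by
      rw [div_le_one (by linarith)]; linarith
    rw [e1]
    have e3 : q * y ^ 2 * ((1 - q) / ((m : ℝ) - 1)) ≤ q * y ^ 2 * 1 := by gcongr
    have e4 : lam * ((ε ^ m) ^ 2 + ε ^ m) ≤ (ε ^ m) ^ 2 + ε ^ m :=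
      mul_le_of_le_one_left (by positivity) hlam1
    have e5 : (ε ^ m) ^ 2 + ε ^ m ≤ q + q * ε ^ m := by
      rw [hp]
      have : q * ε ≤ q := by nlinarith
      nlinarith [mul_nonneg hq0.le hε.le]
    have e6 := mul_le_mul_of_nonneg_right (e4.trans e5) (sq_nonneg y)
    nlinarith [mul_nonneg (mul_nonneg hq0.le hpm.le) (sq_nonneg y)]
  have hB' := div_le_div_of_nonneg_right hB ha0.le
  have e : lam * (ε ^ m * (sphereVar f ε + y ^ 2 / a) + (sphereVar f 1 + (ε ^ m * y) ^ 2 / a)) =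
      lam * sphereVar f 1 + lam * (ε ^ m * sphereVar f ε) +
      lam * ((ε ^ m) ^ 2 + ε ^ m) * y ^ 2 / a := by ring
  rw [e]
  linarith

end AnnulusLowerBound

section CoordinateMoments

variable {m : ℕ}

lemma ae_unitSphereMeasure_norm_eq_one : ∀ᵐ x ∂(unitSphereMeasure m), ‖x‖ = 1 :=
  isRotationInvariantOnSphere_unitSphereMeasure.ae_norm_eq_one

lemma integral_unitSphereMeasure_coord :
    ∫ x, x 0 ∂(unitSphereMeasure m) = 0 := by
  have h := isRotationInvariantOnSphere_unitSphereMeasure (m := m).integral_comp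
    (LinearIsometryEquiv.neg ℝ) (fun x => x 0)
  simp only [LinearIsometryEquiv.coe_neg, PiLp.neg_apply, integral_neg] at h
  linarith

lemma integral_unitSphereMeasure_coord_sq :
    (m + 1) * ∫ x, x 0 ^ 2 ∂(unitSphereMeasure m) = (unitSphereMeasure m).real Set.univ := by
  have hi : ∀ i : Fin (m + 1), ∫ x, x i ^ 2 ∂(unitSphereMeasure m) =
      ∫ x, x 0 ^ 2 ∂(unitSphereMeasure m) := fun i => by
    have h := isRotationInvariantOnSphere_unitSphereMeasure (m := m).integral_comp
      (LinearIsometryEquiv.piLpCongrLeft 2 ℝ ℝ (Equiv.swap 0 i)) (fun x => x 0 ^ 2)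
    simpa [LinearIsometryEquiv.piLpCongrLeft_apply, Equiv.piCongrLeft'_apply] using h
  have hsum : ∫ x, ∑ i, x i ^ 2 ∂(unitSphereMeasure m) =
      (unitSphereMeasure m).real Set.univ := by
    rw [integral_congr_ae (g := fun _ => (1 : ℝ))]
    · simp
    · filter_upwards [ae_unitSphereMeasure_norm_eq_one] with x hx
      rw [← EuclideanSpace.real_norm_sq_eq, hx, one_pow]
  rw [integral_finsetSum _ fun i _ => integrable_unitSphereMeasure (by fun_prop)] at hsum
  simp only [hi, Finset.sum_const, Finset.card_univ, Fintype.card_fin, nsmul_eq_mul] at hsum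
  rw [← hsum]
  push_cast
  ring

lemma contDiff_coord {k : WithTop ℕ∞} :
    ContDiff ℝ k fun x : EuclideanSpace ℝ (Fin (m + 1)) => x 0 := by
  fun_prop

lemma norm_gradient_coord (x : EuclideanSpace ℝ (Fin (m + 1))) :
    ‖gradient (fun y : EuclideanSpace ℝ (Fin (m + 1)) => y 0) x‖ = 1 := by
  have : HasGradientAt (fun y : EuclideanSpace ℝ (Fin (m + 1)) => y 0)
      (EuclideanSpace.single 0 1) x := by
    rw [hasGradientAt_iff_hasFDerivAt]
    refine (EuclideanSpace.proj (𝕜 := ℝ) (0 : Fin (m + 1))).hasFDerivAt.congr_fderiv ?_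
    ext v
    simp [EuclideanSpace.inner_single_left]
  rw [this.gradient]
  simp

end CoordinateMoments

section RadialFunctionals

variable {m : ℕ}

/-- The integral of `f` over the boundary of the annulus with radii `ε` and `1`. -/
noncomputable def shellIntegral (ε : ℝ) (f : EuclideanSpace ℝ (Fin (m + 1)) → ℝ) : ℝ :=
  ε ^ m * sphereMean f ε + sphereMean f 1

/-- The Dirichlet energy of `f` on the annulus with radii `ε` and `1`, in polar coordinates. -/
noncomputable def shellEnergy (ε : ℝ) (f : EuclideanSpace ℝ (Fin (m + 1)) → ℝ) : ℝ :=
  polarConst m * ∫ r in ε..1, r ^ m * sphereMean (fun x => ‖gradient f x‖ ^ 2) r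

/-- The Rayleigh quotients of the admissible test functions on the annulus. -/
def shellQuotients (m : ℕ) (ε : ℝ) : Set ℝ :=
  {q | ∃ f : EuclideanSpace ℝ (Fin (m + 1)) → ℝ, ContDiff ℝ (⊤ : ℕ∞) f ∧
    shellIntegral ε f = 0 ∧ 0 < shellIntegral ε (fun x => f x ^ 2) ∧
    q = shellEnergy ε f / shellIntegral ε (fun x => f x ^ 2)}

lemma frontier_annulus {E : Type*} [NormedAddCommGroup E] [NormedSpace ℝ E] {ε : ℝ}
    (hε : 0 < ε) (hε1 : ε < 1) :
    frontier {x : E | ε < ‖x‖ ∧ ‖x‖ < 1} = Metric.sphere 0 ε ∪ Metric.sphere 0 1 := by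
  have hopen : IsOpen {x : E | ε < ‖x‖ ∧ ‖x‖ < 1} :=
    (isOpen_lt continuous_const continuous_norm).inter (isOpen_lt continuous_norm continuous_const)
  have hcl : closure {x : E | ε < ‖x‖ ∧ ‖x‖ < 1} = {x : E | ε ≤ ‖x‖ ∧ ‖x‖ ≤ 1} := by
    refine (closure_minimal (Set.ofPred_subset_ofPred.2 fun x hx => ⟨hx.1.le, hx.2.le⟩)
      ((isClosed_le continuous_const continuous_norm).inter
        (isClosed_le continuous_norm continuous_const))).antisymm fun x hx => ?_
    have hx0 : 0 < ‖x‖ := hε.trans_le hx.1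
    have hmem : ‖x‖ ∈ closure (Set.Ioo ε 1) := by
      rw [closure_Ioo hε1.ne]; exact hx
    have hmap : Set.MapsTo (fun t : ℝ => (t / ‖x‖) • x) (Set.Ioo ε 1)
        {x : E | ε < ‖x‖ ∧ ‖x‖ < 1} := fun t ht => by
      have : ‖(t / ‖x‖) • x‖ = t := by
        rw [norm_smul, Real.norm_of_nonneg (div_pos (hε.trans ht.1) hx0).le,
          div_mul_cancel₀ _ hx0.ne']
      simp only [Set.mem_ofPred_eq, this]
      exact ht
    have := map_mem_closure (by fun_prop) hmem hmap
    simpa [div_self hx0.ne'] using this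
  rw [hopen.frontier_eq, hcl]
  ext x
  simp only [Set.mem_sdiff, Set.mem_ofPred_eq, Set.mem_union, mem_sphere_zero_iff_norm]
  grind

lemma setIntegral_frontier_annulus {ε : ℝ} (hε : 0 < ε) (hε1 : ε < 1)
    {f : EuclideanSpace ℝ (Fin (m + 1)) → ℝ} (hf : Continuous f) :
    ∫ x in frontier {x : EuclideanSpace ℝ (Fin (m + 1)) | ε < ‖x‖ ∧ ‖x‖ < 1}, f x ∂μH[(m : ℝ)] =
      shellIntegral ε f := by
  rw [frontier_annulus hε hε1, setIntegral_union _ Metric.isClosed_sphere.measurableSet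
    (integrableOn_sphere hε hf) (integrableOn_sphere one_pos hf), integral_sphere_eq hε,
    integral_sphere_eq one_pos, one_pow, one_mul]
  · rfl
  · exact Set.disjoint_left.2 fun x hx hx' => by
      simp only [mem_sphere_zero_iff_norm] at hx hx'
      exact hε1.ne (hx.symm.trans hx')

lemma setIntegral_frontier_ball (hm : m ≠ 0) (f : EuclideanSpace ℝ (Fin (m + 1)) → ℝ) :
    ∫ x in frontier (Metric.ball (0 : EuclideanSpace ℝ (Fin (m + 1))) 1), f x ∂μH[(m : ℝ)] =
      shellIntegral 0 f := by
  rw [frontier_ball _ one_ne_zero, integral_sphere_eq one_pos, shellIntegral, zero_pow hm,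
    zero_mul, zero_add, one_pow, one_mul, sphereMean]

lemma sphereMean_const (c r : ℝ) :
    sphereMean (m := m) (fun _ => c) r = (unitSphereMeasure m).real Set.univ * c := by
  simp [sphereMean]

lemma shellIntegral_const (ε c : ℝ) : shellIntegral (m := m) ε (fun _ => c) =
    (1 + ε ^ m) * (unitSphereMeasure m).real Set.univ * c := by
  rw [shellIntegral, sphereMean_const, sphereMean_const]
  ring

lemma hausdorffMeasure_frontier_annulus {ε : ℝ} (hε : 0 < ε) (hε1 : ε < 1) :
    (μH[(m : ℝ)] (frontier {x : EuclideanSpace ℝ (Fin (m + 1)) | ε < ‖x‖ ∧ ‖x‖ < 1})).toReal =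
      (1 + ε ^ m) * (unitSphereMeasure m).real Set.univ := by
  have h := setIntegral_frontier_annulus (m := m) hε hε1 (f := fun _ => 1) continuous_const
  rwa [setIntegral_const, shellIntegral_const, smul_eq_mul, mul_one, mul_one] at h

lemma hausdorffMeasure_frontier_ball (hm : m ≠ 0) :
    (μH[(m : ℝ)] (frontier (Metric.ball (0 : EuclideanSpace ℝ (Fin (m + 1))) 1))).toReal =
      (1 + 0 ^ m) * (unitSphereMeasure m).real Set.univ := by
  have h := setIntegral_frontier_ball hm fun _ => 1
  rwa [setIntegral_const, shellIntegral_const, smul_eq_mul, mul_one, mul_one] at h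

lemma setIntegral_annulus_gradient {ε : ℝ} (h0 : 0 ≤ ε) (h1 : ε ≤ 1)
    {f : EuclideanSpace ℝ (Fin (m + 1)) → ℝ} (hf : ContDiff ℝ 1 f) :
    ∫ x in {x : EuclideanSpace ℝ (Fin (m + 1)) | ε < ‖x‖ ∧ ‖x‖ < 1}, ‖gradient f x‖ ^ 2 =
      shellEnergy ε f :=
  setIntegral_annulus_eq ((hf.continuous_gradient one_ne_zero).norm.pow 2) h0 h1

lemma setIntegral_ball_gradient {f : EuclideanSpace ℝ (Fin (m + 1)) → ℝ} (hf : ContDiff ℝ 1 f) :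
    ∫ x in Metric.ball (0 : EuclideanSpace ℝ (Fin (m + 1))) 1, ‖gradient f x‖ ^ 2 =
      shellEnergy 0 f := by
  rw [← setIntegral_annulus_gradient le_rfl zero_le_one hf]
  refine setIntegral_congr_set (ae_eq_symm ?_)
  have : {x : EuclideanSpace ℝ (Fin (m + 1)) | 0 < ‖x‖ ∧ ‖x‖ < 1} =
      Metric.ball 0 1 \ {0} := by
    ext x
    simp [and_comm]
  rw [this]
  exact sdiff_null_ae_eq_self (measure_singleton 0)

lemma stekSigma1_annulus {ε : ℝ} (hε : 0 < ε) (hε1 : ε < 1) :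
    stekSigma1 {x : EuclideanSpace ℝ (Fin (m + 1)) | ε < ‖x‖ ∧ ‖x‖ < 1} =
      sInf (shellQuotients m ε) := by
  rw [stekSigma1, shellQuotients]
  congr 1
  ext q
  simp only [Set.mem_ofPred_eq]
  refine exists_congr fun f => and_congr_right fun hf => ?_
  rw [Nat.cast_succ, add_sub_cancel_right, setIntegral_frontier_annulus hε hε1 hf.continuous,
    setIntegral_frontier_annulus hε hε1 (f := fun x => f x ^ 2) (hf.continuous.pow 2),
    setIntegral_annulus_gradient hε.le hε1.le (hf.of_le (mod_cast le_top))]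

lemma stekSigma1_ball (hm : m ≠ 0) :
    stekSigma1 (Metric.ball (0 : EuclideanSpace ℝ (Fin (m + 1))) 1) =
      sInf (shellQuotients m 0) := by
  rw [stekSigma1, shellQuotients]
  congr 1
  ext q
  simp only [Set.mem_ofPred_eq]
  refine exists_congr fun f => and_congr_right fun hf => ?_
  rw [Nat.cast_succ, add_sub_cancel_right, setIntegral_frontier_ball hm,
    setIntegral_frontier_ball hm, setIntegral_ball_gradient (hf.of_le (mod_cast le_top))]

end RadialFunctionals

section RadialOptimization

variable {m : ℕ}

lemma shellIntegral_coord (ε : ℝ) :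
    shellIntegral ε (fun x : EuclideanSpace ℝ (Fin (m + 1)) => x 0) = 0 := by
  simp [shellIntegral, sphereMean, integral_const_mul, integral_unitSphereMeasure_coord]

lemma shellIntegral_coord_sq (ε : ℝ) :
    shellIntegral ε (fun x : EuclideanSpace ℝ (Fin (m + 1)) => x 0 ^ 2) =
      (ε ^ (m + 2) + 1) * ((unitSphereMeasure m).real Set.univ / (m + 1)) := by
  have h : ∫ x, x 0 ^ 2 ∂(unitSphereMeasure m) =
      (unitSphereMeasure m).real Set.univ / (m + 1) := by
    rw [eq_div_iff (by positivity), mul_comm, integral_unitSphereMeasure_coord_sq]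
  simp only [shellIntegral, sphereMean, PiLp.smul_apply, smul_eq_mul, mul_pow,
    integral_const_mul, h]
  ring

lemma shellEnergy_coord : shellEnergy 0 (fun x : EuclideanSpace ℝ (Fin (m + 1)) => x 0) =
    polarConst m * ((unitSphereMeasure m).real Set.univ / (m + 1)) := by
  simp only [shellEnergy, norm_gradient_coord, one_pow, sphereMean_const,
    intervalIntegral.integral_mul_const, integral_pow, one_pow,
    zero_pow m.succ_ne_zero]
  ring

lemma shellEnergy_nonneg {ε : ℝ} (h0 : 0 ≤ ε) (h1 : ε ≤ 1)
    (f : EuclideanSpace ℝ (Fin (m + 1)) → ℝ) : 0 ≤ shellEnergy ε f :=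
  mul_nonneg polarConst_pos.le (intervalIntegral.integral_nonneg h1 fun _ hr =>
    mul_nonneg (pow_nonneg (h0.trans hr.1) m) (integral_nonneg fun _ => sq_nonneg _))

lemma shellQuotients_nonneg {ε : ℝ} (h0 : 0 ≤ ε) (h1 : ε ≤ 1) :
    ∀ q ∈ shellQuotients m ε, 0 ≤ q := by
  rintro q ⟨f, -, -, hpos, rfl⟩
  exact div_nonneg (shellEnergy_nonneg h0 h1 f) hpos.le

lemma bddBelow_shellQuotients {ε : ℝ} (h0 : 0 ≤ ε) (h1 : ε ≤ 1) :
    BddBelow (shellQuotients m ε) :=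
  ⟨0, shellQuotients_nonneg h0 h1⟩

lemma coord_quotient_mem_shellQuotients {ε : ℝ} (h0 : 0 ≤ ε) :
    shellEnergy ε (fun x : EuclideanSpace ℝ (Fin (m + 1)) => x 0) /
      shellIntegral ε (fun x : EuclideanSpace ℝ (Fin (m + 1)) => x 0 ^ 2) ∈
      shellQuotients m ε := by
  refine ⟨fun x => x 0, contDiff_coord, shellIntegral_coord ε, ?_, rfl⟩
  rw [shellIntegral_coord_sq]
  have := unitSphereMeasure_real_univ_pos (m := m)
  positivity

lemma sInf_shellQuotients_zero_le (hm : m ≠ 0) : sInf (shellQuotients m 0) ≤ polarConst m := by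
  refine (csInf_le (bddBelow_shellQuotients le_rfl zero_le_one)
    (coord_quotient_mem_shellQuotients le_rfl)).trans_eq ?_
  have := unitSphereMeasure_real_univ_pos (m := m)
  rw [shellEnergy_coord, shellIntegral_coord_sq, zero_pow (by omega), zero_add, one_mul,
    mul_div_assoc, div_self (by positivity), mul_one]

lemma sInf_shellQuotients_one : sInf (shellQuotients m 1) ≤ 0 := by
  refine (csInf_le (bddBelow_shellQuotients zero_le_one le_rfl)
    (coord_quotient_mem_shellQuotients zero_le_one)).trans_eq ?_
  simp [shellEnergy]

lemma le_sInf_shellQuotients (hm : 2 ≤ m) {ε : ℝ} (hε : 0 < ε) (hε1 : ε ≤ 1 / 2) :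
    polarConst m * ((1 - m * ε ^ (m + 1)) / (1 + ε ^ (m + 1))) ≤ sInf (shellQuotients m ε) := by
  refine le_csInf ⟨_, coord_quotient_mem_shellQuotients hε.le⟩ ?_
  rintro q ⟨f, hf, hmean, hpos, rfl⟩
  rw [le_div_iff₀ hpos, shellEnergy, mul_assoc]
  refine mul_le_mul_of_nonneg_left ?_ polarConst_pos.le
  refine annulus_energy_lower_bound hm (hf.of_le (mod_cast le_top)) hε hε1 ?_
  rw [shellIntegral] at hmean
  linarith

lemma continuous_shellIntegral {f : EuclideanSpace ℝ (Fin (m + 1)) → ℝ} (hf : Continuous f) :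
    Continuous fun ε => shellIntegral ε f :=
  ((continuous_pow m).mul (continuous_sphereMean hf)).add continuous_const

lemma continuous_shellEnergy {f : EuclideanSpace ℝ (Fin (m + 1)) → ℝ} (hf : ContDiff ℝ 1 f) :
    Continuous fun ε => shellEnergy ε f := by
  have hg := hf.continuous_gradient one_ne_zero
  have hc : Continuous fun r : ℝ => r ^ m * sphereMean (fun x => ‖gradient f x‖ ^ 2) r :=
    (continuous_pow m).mul (continuous_sphereMean (by fun_prop))
  simp only [shellEnergy, intervalIntegral.integral_symm 1]
  exact continuous_const.mul
    (intervalIntegral.continuous_primitive (fun a b => hc.intervalIntegrable a b) 1).neg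

lemma shellIntegral_sub_const {f : EuclideanSpace ℝ (Fin (m + 1)) → ℝ} (hf : Continuous f)
    (ε c : ℝ) : shellIntegral ε (fun x => f x - c) =
      shellIntegral ε f - (1 + ε ^ m) * (unitSphereMeasure m).real Set.univ * c := by
  have h : ∀ r, sphereMean (fun x => f x - c) r =
      sphereMean f r - (unitSphereMeasure m).real Set.univ * c := fun r => by
    rw [← sphereMean_const c r]
    exact integral_sub (integrable_unitSphereMeasure (by fun_prop)) (integrable_const c)
  simp only [shellIntegral, h]
  ring

lemma shellIntegral_sub_const_sq {f : EuclideanSpace ℝ (Fin (m + 1)) → ℝ} (hf : Continuous f)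
    (ε c : ℝ) : shellIntegral ε (fun x => (f x - c) ^ 2) = shellIntegral ε (fun x => f x ^ 2) -
      2 * c * shellIntegral ε f + (1 + ε ^ m) * (unitSphereMeasure m).real Set.univ * c ^ 2 := by
  have h : ∀ r, sphereMean (fun x => (f x - c) ^ 2) r = sphereMean (fun x => f x ^ 2) r -
      2 * c * sphereMean f r + (unitSphereMeasure m).real Set.univ * c ^ 2 := fun r => by
    have e : ∀ x, (f (r • x) - c) ^ 2 = f (r • x) ^ 2 - 2 * c * f (r • x) + c ^ 2 :=
      fun x => by ring
    simp only [sphereMean, e]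
    rw [integral_add (integrable_unitSphereMeasure (by fun_prop)) (integrable_const _),
      integral_sub (integrable_unitSphereMeasure (by fun_prop))
        (integrable_unitSphereMeasure (by fun_prop)), integral_const_mul]
    simp
  simp only [shellIntegral, h]
  ring

lemma gradient_sub_const {E : Type*} [NormedAddCommGroup E] [InnerProductSpace ℝ E]
    [CompleteSpace E] (f : E → ℝ) (c : ℝ) (x : E) :
    gradient (fun y => f y - c) x = gradient f x := by
  simp only [gradient, fderiv_sub_const]

/-- The first Steklov eigenvalue of the annulus, normalized by the boundary area. -/
noncomputable def normalizedSigma1 (m : ℕ) (ε : ℝ) : ℝ :=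
  sInf (shellQuotients m ε) *
    ((1 + ε ^ m) * (unitSphereMeasure m).real Set.univ) ^ (1 / (m : ℝ))

lemma upperSemicontinuousOn_normalizedSigma1 :
    UpperSemicontinuousOn (normalizedSigma1 m) (Set.Icc 0 1) := by
  intro ε₀ hε₀ y hy
  have ha := unitSphereMeasure_real_univ_pos (m := m)
  set a := (unitSphereMeasure m).real Set.univ with hadef
  have hmass : ∀ ε ∈ Set.Icc (0 : ℝ) 1, 0 < (1 + ε ^ m) * a := fun ε hε => by
    have := pow_nonneg hε.1 m
    positivity
  have hw : ∀ ε ∈ Set.Icc (0 : ℝ) 1, 0 < ((1 + ε ^ m) * a) ^ (1 / (m : ℝ)) := fun ε hε =>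
    Real.rpow_pos_of_pos (hmass ε hε) _
  obtain ⟨q, ⟨f, hf, hmean, hpos, rfl⟩, hq⟩ := exists_lt_of_csInf_lt
    ⟨_, coord_quotient_mem_shellQuotients hε₀.1⟩ ((lt_div_iff₀ (hw ε₀ hε₀)).2 hy)
  have hf1 : ContDiff ℝ 1 f := hf.of_le (mod_cast le_top)
  have hfc := hf.continuous
  set c : ℝ → ℝ := fun ε => shellIntegral ε f / ((1 + ε ^ m) * a) with hc
  set v : ℝ → ℝ := fun ε => shellIntegral ε (fun x => f x ^ 2) -
      2 * c ε * shellIntegral ε f + (1 + ε ^ m) * a * c ε ^ 2 with hv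
  have hc0 : c ε₀ = 0 := by simp [hc, hmean]
  have hv0 : v ε₀ = shellIntegral ε₀ (fun x => f x ^ 2) := by simp [hv, hc0]
  have hIf := continuous_shellIntegral hfc
  have hIf2 := continuous_shellIntegral (f := fun x => f x ^ 2) (hfc.pow 2)
  have hmc : Continuous fun ε : ℝ => (1 + ε ^ m) * a := by fun_prop
  have hcc : ContinuousAt c ε₀ := hIf.continuousAt.div hmc.continuousAt (hmass ε₀ hε₀).ne'
  have hvc : ContinuousAt v ε₀ :=
    (hIf2.continuousAt.sub ((continuousAt_const.mul hcc).mul hIf.continuousAt)).add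
      (hmc.continuousAt.mul (hcc.pow 2))
  have hv0pos : 0 < v ε₀ := hv0 ▸ hpos
  have hQ : ContinuousAt (fun ε => shellEnergy ε f / v ε * ((1 + ε ^ m) * a) ^ (1 / (m : ℝ))) ε₀ :=
    ((continuous_shellEnergy hf1).continuousAt.div hvc hv0pos.ne').mul
      (hmc.continuousAt.rpow_const (Or.inl (hmass ε₀ hε₀).ne'))
  have hlt : shellEnergy ε₀ f / v ε₀ * ((1 + ε₀ ^ m) * a) ^ (1 / (m : ℝ)) < y := by
    rw [hv0]
    exact (lt_div_iff₀ (hw ε₀ hε₀)).1 hq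
  filter_upwards [nhdsWithin_le_nhds (hQ.eventually_lt_const hlt),
    nhdsWithin_le_nhds (hvc.eventually_const_lt hv0pos), self_mem_nhdsWithin] with ε h1 h2 hε
  refine lt_of_le_of_lt ?_ h1
  refine mul_le_mul_of_nonneg_right ?_ (hw ε hε).le
  refine csInf_le (bddBelow_shellQuotients hε.1 hε.2)
    ⟨fun x => f x - c ε, hf.sub contDiff_const, ?_, ?_, ?_⟩
  · rw [shellIntegral_sub_const hfc, ← hadef, hc]
    simp only
    rw [mul_div_cancel₀ _ (hmass ε hε).ne', sub_self]
  · rw [shellIntegral_sub_const_sq hfc]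
    exact h2
  · rw [shellIntegral_sub_const_sq hfc]
    simp only [shellEnergy, gradient_sub_const]
    rfl

lemma exists_normalizedSigma1_lt (hm : 2 ≤ m) :
    ∃ ε ∈ Set.Ioo (0 : ℝ) 1, normalizedSigma1 m 0 < normalizedSigma1 m ε := by
  have ha := unitSphereMeasure_real_univ_pos (m := m)
  have hmR : (2 : ℝ) ≤ m := by exact_mod_cast hm
  set ε : ℝ := 1 / (2 * ((m : ℝ) + 1) ^ 2) with hεdef
  have hε : 0 < ε := by positivity
  have hε2 : 2 * ((m : ℝ) + 1) ^ 2 * ε = 1 := by rw [hεdef]; field_simp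
  have hε1 : ε ≤ 1 / 2 := by nlinarith [mul_pos hε hε]
  refine ⟨ε, ⟨hε, by linarith⟩, ?_⟩
  set lam := (1 - m * ε ^ (m + 1)) / (1 + ε ^ (m + 1)) with hlam
  have hp : 0 < ε ^ m := by positivity
  have hp1 : ε ^ m ≤ 1 := pow_le_one₀ hε.le (by linarith)
  have hps : ε ^ (m + 1) = ε ^ m * ε := pow_succ _ _
  have hlam_ge : 1 + -((m + 1) * ε ^ (m + 1)) ≤ lam := by
    rw [hlam, le_div_iff₀ (by positivity)]
    nlinarith [mul_pos (pow_pos hε (m + 1)) (pow_pos hε (m + 1))]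
  have hme : (m : ℝ) * (m + 1) * ε < 1 / 2 := by nlinarith
  have hsmall : (m + 1) * ε ^ (m + 1) ≤ 1 / 2 := by
    rw [hps]
    nlinarith [mul_pos hp hε]
  have hlam0 : 0 < lam := by linarith
  have hbern : 1 + (m : ℝ) * -((m + 1) * ε ^ (m + 1)) ≤ lam ^ m :=
    (one_add_mul_le_pow (by linarith) m).trans (pow_le_pow_left₀ (by linarith) hlam_ge m)
  have hkey : 1 < lam ^ m * (1 + ε ^ m) := by
    refine lt_of_lt_of_le ?_ (mul_le_mul_of_nonneg_right hbern (by positivity))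
    rw [hps]
    nlinarith [mul_lt_mul_of_pos_left hme hp, mul_lt_mul_of_pos_left hme (mul_pos hp hp),
      mul_le_mul_of_nonneg_left hp1 hp.le]
  have hm0 : (m : ℝ) ≠ 0 := by positivity
  have hroot : 1 < lam * (1 + ε ^ m) ^ (1 / (m : ℝ)) := by
    have h := Real.one_lt_rpow hkey (z := 1 / (m : ℝ)) (by positivity)
    rwa [Real.mul_rpow (by positivity) (by positivity), ← Real.rpow_natCast, ← Real.rpow_mul
      hlam0.le, mul_one_div_cancel hm0, Real.rpow_one] at h
  set a := (unitSphereMeasure m).real Set.univ with hadef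
  have haw : 0 < a ^ (1 / (m : ℝ)) := Real.rpow_pos_of_pos ha _
  calc normalizedSigma1 m 0 ≤ polarConst m * a ^ (1 / (m : ℝ)) := by
        rw [normalizedSigma1, zero_pow (by omega), add_zero, one_mul]
        exact mul_le_mul_of_nonneg_right (sInf_shellQuotients_zero_le (by omega)) haw.le
    _ < polarConst m * a ^ (1 / (m : ℝ)) * (lam * (1 + ε ^ m) ^ (1 / (m : ℝ))) :=
        lt_mul_of_one_lt_right (mul_pos polarConst_pos haw) hroot
    _ = polarConst m * lam * ((1 + ε ^ m) * a) ^ (1 / (m : ℝ)) := by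
        rw [Real.mul_rpow (by positivity) ha.le]
        ring
    _ ≤ normalizedSigma1 m ε :=
        mul_le_mul_of_nonneg_right (le_sInf_shellQuotients hm hε hε1) (by positivity)

/-- The normalized first Steklov eigenvalue is maximized by a proper annulus. -/
lemma exists_isMaxOn_normalizedSigma1 (hm : 2 ≤ m) : ∃ δ ∈ Set.Ioo (0 : ℝ) 1,
    (∀ ε ∈ Set.Icc (0 : ℝ) 1, normalizedSigma1 m ε ≤ normalizedSigma1 m δ) ∧
      normalizedSigma1 m 0 < normalizedSigma1 m δ := by
  obtain ⟨δ, hδ, hmax⟩ := upperSemicontinuousOn_normalizedSigma1 (m := m).exists_isMaxOn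
    (Set.nonempty_Icc.2 zero_le_one) isCompact_Icc
  obtain ⟨ε, hε, hlt⟩ := exists_normalizedSigma1_lt hm
  have hlt' := hlt.trans_le (hmax ⟨hε.1.le, hε.2.le⟩)
  have ha := unitSphereMeasure_real_univ_pos (m := m)
  have h0 : 0 ≤ normalizedSigma1 m 0 :=
    mul_nonneg (Real.sInf_nonneg (shellQuotients_nonneg le_rfl zero_le_one)) (by positivity)
  have h1 : normalizedSigma1 m 1 ≤ 0 :=
    mul_nonpos_of_nonpos_of_nonneg sInf_shellQuotients_one (by positivity)
  refine ⟨δ, ⟨hδ.1.lt_of_ne ?_, hδ.2.lt_of_ne ?_⟩, fun ε hε => hmax hε, hlt'⟩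
  · rintro rfl
    exact hlt'.false
  · rintro rfl
    linarith

end RadialOptimization

/-- The maximum of the normalized first Steklov eigenvalue over rotationally symmetric
connected domains (the ball at `ε = 0`, annuli `A_ε` for `ε ∈ (0,1)`) is achieved by some
annulus and strictly exceeds the value for the ball. -/
theorem stmt17 {n : ℕ} (hn : 3 ≤ n) (F : ℝ → ℝ)
    (hF0 : F 0 = stekSigma1 (Metric.ball (0 : EuclideanSpace ℝ (Fin n)) 1) *
      (μH[(n : ℝ) - 1] (frontier (Metric.ball (0 : EuclideanSpace ℝ (Fin n)) 1))).toReal ^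
        ((1 : ℝ) / ((n : ℝ) - 1)))
    (hFε : ∀ ε ∈ Set.Ioo (0 : ℝ) 1,
      F ε = stekSigma1 {x : EuclideanSpace ℝ (Fin n) | ε < ‖x‖ ∧ ‖x‖ < 1} *
        (μH[(n : ℝ) - 1]
            (frontier {x : EuclideanSpace ℝ (Fin n) | ε < ‖x‖ ∧ ‖x‖ < 1})).toReal ^
          ((1 : ℝ) / ((n : ℝ) - 1))) :
    ∃ εstar ∈ Set.Ioo (0 : ℝ) 1,
      (∀ ε ∈ Set.Ico (0 : ℝ) 1, F ε ≤ F εstar) ∧ F 0 < F εstar := by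
  obtain ⟨m, rfl⟩ : ∃ m, n = m + 1 := ⟨n - 1, by omega⟩
  have hm : 2 ≤ m := by omega
  simp only [Nat.cast_succ, add_sub_cancel_right] at hF0 hFε
  have h0 : F 0 = normalizedSigma1 m 0 := by
    rw [hF0, stekSigma1_ball (by omega), hausdorffMeasure_frontier_ball (by omega),
      normalizedSigma1]
  have hpos : ∀ ε ∈ Set.Ioo (0 : ℝ) 1, F ε = normalizedSigma1 m ε := fun ε hε => by
    rw [hFε ε hε, stekSigma1_annulus hε.1 hε.2, hausdorffMeasure_frontier_annulus hε.1 hε.2,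
      normalizedSigma1]
  obtain ⟨δ, hδ, hmax, hlt⟩ := exists_isMaxOn_normalizedSigma1 hm
  refine ⟨δ, hδ, fun ε hε => ?_, ?_⟩
  · rw [hpos δ hδ]
    rcases hε.1.eq_or_lt with rfl | hε0
    · exact h0.trans_le hlt.le
    · exact (hpos ε ⟨hε0, hε.2⟩).trans_le (hmax ε ⟨hε.1, hε.2.le⟩)
  · rwa [h0, hpos δ hδ]
end
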